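/- For every ε ∈ (0,1) there is a constant C = C(ε) > 0 with the following property. Let d = 1, p = p_c, t ≥ 1, and let w ≥ 2 be an integer such that V_{p_c}(w,3t) ≥ ε, H_{p_c}(3w,t) ≥ ε, and H_{p_c}(w,3t) ≤ 1 − ε. Then the gyration radius satisfies ξ_t ≤ C·w. -/

import Mathlib

/-!
Common set-up: nearest-neighbour oriented bond percolation on the space-time
lattice `ℤ^d × ℕ`.  A (potential) bond is a pair `((x, s), y)`, representing
the oriented bond from `(x, s)` to `(y, s + 1)` (it is a genuine bond when
`‖x - y‖₁ = 1`).  Each bond is occupied (`true`) with probability `p`,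
independently of all other bonds.  The product Bernoulli(`p`) measure on
configurations is constructed explicitly as the pushforward of the uniform
measure on `[0,1)`: the binary digits of a uniform sample are i.i.d. fair
coin flips, which are re-packed (via the pairing function) into an i.i.d.
sequence of uniform random variables `unif i`, one for each bond, and the
bond indexed by `i` is occupied exactly when `unif i < p`.
-/

open MeasureTheory Filter Set
open scoped Classical ENNReal Topology

namespace OrientedPercolation

/-- A potential bond of the `d`-dimensional space-time lattice: `((x, s), y)`
represents the oriented pair from `(x, s)` to `(y, s + 1)`. -/
abbrev Bond (d : ℕ) := ((Fin d → ℤ) × ℕ) × (Fin d → ℤ)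

/-- A bond configuration: each potential bond is occupied (`true`) or vacant (`false`). -/
abbrev Config (d : ℕ) := Bond d → Bool

/-- The ℓ¹-norm of a point of `ℤ^d`. -/
def norm1 {d : ℕ} (x : Fin d → ℤ) : ℤ := ∑ i, |x i|

/-- The squared Euclidean norm of a point of `ℤ^d`. -/
def normSq {d : ℕ} (x : Fin d → ℤ) : ℤ := ∑ i, (x i) ^ 2

/-- The `n`-th binary digit of `x ∈ [0,1)`. -/
noncomputable def digit (n : ℕ) (x : ℝ) : ℕ := ⌊x * 2 ^ (n + 1)⌋.toNat % 2

/-- From a single uniform sample on `[0,1)`, an i.i.d. sequence of uniform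
samples on `[0,1]`, obtained by splitting the binary digits via the pairing
function. -/
noncomputable def unif (i : ℕ) (x : ℝ) : ℝ :=
  ∑' k : ℕ, (digit (Nat.pair i k) x : ℝ) / 2 ^ (k + 1)

/-- An injective encoding of the bonds by natural numbers. -/
noncomputable def enc (d : ℕ) : Bond d → ℕ := (exists_injective_nat (Bond d)).choose

/-- The i.i.d. Bernoulli(`p`) bond configuration built from a uniform sample `x`. -/
noncomputable def config (d : ℕ) (p : ℝ) (x : ℝ) : Config d :=
  fun b => if unif (enc d b) x < p then true else false

/-- The product Bernoulli(`p`) measure `ℙ_p` on bond configurations. -/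
noncomputable def P (d : ℕ) (p : ℝ) : Measure (Config d) :=
  Measure.map (config d p) ((volume : Measure ℝ).restrict (Set.Ico 0 1))

/-- `ConnectedIn ω R x s y t` : either `(x,s) = (y,t) ∈ R`, or there is a path of
occupied bonds from `(x, s)` to `(y, t)`, all of whose vertices lie in `R`. -/
def ConnectedIn {d : ℕ} (ω : Config d) (R : Set ((Fin d → ℤ) × ℕ))
    (x : Fin d → ℤ) (s : ℕ) (y : Fin d → ℤ) (t : ℕ) : Prop :=
  (x = y ∧ s = t ∧ (x, s) ∈ R) ∨
  (s < t ∧ ∃ v : ℕ → (Fin d → ℤ), v s = x ∧ v t = y ∧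
    (∀ j, s ≤ j → j ≤ t → (v j, j) ∈ R) ∧
    (∀ j, s ≤ j → j < t → norm1 (v (j + 1) - v j) = 1 ∧ ω ((v j, j), v (j + 1)) = true))

/-- `(x, s) → (y, t)` : `(x,s) = (y,t)` or there is a path of occupied bonds from
`(x, s)` to `(y, t)`. -/
def Connected {d : ℕ} (ω : Config d) (x : Fin d → ℤ) (s : ℕ) (y : Fin d → ℤ) (t : ℕ) : Prop :=
  ConnectedIn ω Set.univ x s y t

/-- The survival probability `θ_t = ℙ_p((o,0) → t)`. -/
noncomputable def theta (d : ℕ) (p : ℝ) (t : ℕ) : ℝ :=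
  (P d p {ω | ∃ y, Connected ω 0 0 y t}).toReal

/-- The two-point function `τ(x,t) = ℙ_p((o,0) → (x,t))`. -/
noncomputable def tau (d : ℕ) (p : ℝ) (x : Fin d → ℤ) (t : ℕ) : ℝ :=
  (P d p {ω | Connected ω 0 0 x t}).toReal

/-- The expected number of vertices at time `t` connected from the origin,
`χ_t = Σ_x τ(x,t)`. -/
noncomputable def chi (d : ℕ) (p : ℝ) (t : ℕ) : ℝ := ∑' x : Fin d → ℤ, tau d p x t

/-- The gyration radius `ξ_t = (χ_t⁻¹ Σ_x |x|² τ(x,t))^(1/2)`. -/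
noncomputable def xi (d : ℕ) (p : ℝ) (t : ℕ) : ℝ :=
  Real.sqrt ((∑' x : Fin d → ℤ, (normSq x : ℝ) * tau d p x t) / chi d p t)

/-- The critical point `p_c = inf {p ∈ [0,1] : θ_∞ > 0}` (here `θ_∞ = lim_t θ_t = inf_t θ_t`,
since `θ_t` is nonincreasing in `t` and nonnegative). -/
noncomputable def pc (d : ℕ) : ℝ :=
  sInf {p ∈ Set.Icc (0 : ℝ) 1 | 0 < ⨅ t : ℕ, theta d p t}

/-- The rectangle `[a, b] × [0, t]` (for `d = 1`). -/
def rect (a b : ℤ) (t : ℕ) : Set ((Fin 1 → ℤ) × ℕ) :=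
  {v | a ≤ v.1 0 ∧ v.1 0 ≤ b ∧ v.2 ≤ t}

/-- The rectangle `[a, b] × [0, t]` is crossed vertically: there is a path of occupied
bonds inside the rectangle from some vertex `(x, 0)` to some vertex `(y, t)`. -/
def CrossedVert (ω : Config 1) (a b : ℤ) (t : ℕ) : Prop :=
  ∃ x y : Fin 1 → ℤ, ConnectedIn ω (rect a b t) x 0 y t

/-- The rectangle `[a, b] × [0, t]` is crossed from left to right: there is a path of
occupied bonds inside the rectangle containing a vertex with first coordinate `a` and
a vertex with first coordinate `b`. -/
def CrossedHoriz (ω : Config 1) (a b : ℤ) (t : ℕ) : Prop :=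
  ∃ (x y : Fin 1 → ℤ) (s u : ℕ), x 0 = a ∧ y 0 = b ∧
    (ConnectedIn ω (rect a b t) x s y u ∨ ConnectedIn ω (rect a b t) y u x s)

/-- `V_p(w, t) = ℙ_p([0,w] × [0,t] is crossed vertically)`. -/
noncomputable def V (p : ℝ) (w : ℕ) (t : ℕ) : ℝ :=
  (P 1 p {ω | CrossedVert ω 0 w t}).toReal

/-- `H_p(w, t) = ℙ_p([0,w] × [0,t] is crossed from left to right)`. -/
noncomputable def H (p : ℝ) (w : ℕ) (t : ℕ) : ℝ :=
  (P 1 p {ω | CrossedHoriz ω 0 w t}).toReal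

/-- The event that `(o, 0)` is connected, inside the box `B_o = [-w,w] × [0,t]`, to the
boundary `∂B_o = {(x,s) ∈ B_o : s = t or |x| = w}`. -/
def ToBoundary (ω : Config 1) (w : ℕ) (t : ℕ) : Prop :=
  ∃ (y : Fin 1 → ℤ) (s : ℕ), (s = t ∨ |y 0| = w) ∧
    ConnectedIn ω (rect (-(w : ℤ)) w t) 0 0 y s


section measure

/-- The fair coin on `{0,1} ⊆ ℕ`. -/
noncomputable def coin : Measure ℕ :=
  (2⁻¹ : ℝ≥0∞) • Measure.dirac 0 + (2⁻¹ : ℝ≥0∞) • Measure.dirac 1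

instance : IsProbabilityMeasure coin := by
  constructor
  simp [coin, ENNReal.inv_two_add_inv_two]

lemma measurable_digit (n : ℕ) : Measurable (digit n) := by
  unfold digit
  have h1 : Measurable (fun x : ℝ => ⌊x * 2 ^ (n + 1)⌋) :=
    Int.measurable_floor.comp (measurable_id.mul_const _)
  exact (measurable_from_top (f := fun z : ℤ => z.toNat % 2)).comp h1

lemma digit_zero_left {x : ℝ} (h0 : 0 ≤ x) (h1 : x < 1 / 2) : digit 0 x = 0 := by
  unfold digit
  have : ⌊x * 2 ^ (0 + 1)⌋ = 0 := by
    rw [Int.floor_eq_iff]; constructor <;> norm_num <;> linarith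
  rw [this]; rfl

lemma digit_zero_right {x : ℝ} (h0 : 1 / 2 ≤ x) (h1 : x < 1) : digit 0 x = 1 := by
  unfold digit
  have : ⌊x * 2 ^ (0 + 1)⌋ = 1 := by
    rw [Int.floor_eq_iff]; constructor <;> norm_num <;> linarith
  rw [this]; rfl

lemma digit_succ_left (n : ℕ) (x : ℝ) : digit (n + 1) x = digit n (2 * x) := by
  unfold digit
  have : x * 2 ^ (n + 1 + 1) = 2 * x * 2 ^ (n + 1) := by ring
  rw [this]

lemma digit_succ_right (n : ℕ) (x : ℝ) (hx : 1 / 2 ≤ x) :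
    digit (n + 1) x = digit n (2 * x - 1) := by
  unfold digit
  have : (2 * x - 1) * 2 ^ (n + 1) = x * 2 ^ (n + 1 + 1) - ((2 ^ (n + 1) : ℤ) : ℝ) := by
    push_cast; ring
  rw [this, Int.floor_sub_intCast]
  have h0 : (0 : ℝ) ≤ (2 * x - 1) * 2 ^ (n + 1) := by
    apply mul_nonneg; linarith; positivity
  have h1 : 0 ≤ ⌊x * 2 ^ (n + 1 + 1)⌋ - 2 ^ (n + 1) := by
    rw [this] at h0
    have := Int.floor_nonneg.2 h0
    rwa [Int.floor_sub_intCast] at this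
  have h2 : (2 : ℤ) ^ (n + 1) = 2 * 2 ^ n := by ring
  rw [h2] at h1 ⊢
  have h3 : (0 : ℤ) ≤ 2 ^ n := by positivity
  generalize ⌊x * 2 ^ (n + 1 + 1)⌋ = m at *
  generalize (2 : ℤ) ^ n = k at *
  omega

lemma volume_half (a : ℝ) (A : Set ℝ) :
    volume ((fun x : ℝ => 2 * x - a) ⁻¹' A) = 2⁻¹ * volume A := by
  have : (fun x : ℝ => 2 * x - a) ⁻¹' A =
      (fun x : ℝ => 2 * x) ⁻¹' ((fun x : ℝ => x + (-a)) ⁻¹' A) := by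
    ext x; simp [sub_eq_add_neg]
  rw [this, Real.volume_preimage_mul_left (by norm_num), measure_preimage_add_right]
  congr 1
  rw [abs_of_pos (by norm_num), ENNReal.ofReal_inv_of_pos (by norm_num)]
  norm_num

lemma digits_cyl (n : ℕ) : ∀ t : ℕ → Set ℕ,
    volume ({x : ℝ | ∀ i < n, digit i x ∈ t i} ∩ Set.Ico 0 1) =
      ∏ i ∈ Finset.range n, coin (t i) := by
  induction n with
  | zero => intro t; simp
  | succ n ih =>
    intro t
    set B : Set ℝ := {x : ℝ | ∀ i < n, digit i x ∈ t (i + 1)} ∩ Set.Ico 0 1 with hB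
    have hBm : MeasurableSet B := by
      refine MeasurableSet.inter ?_ measurableSet_Ico
      have : {x : ℝ | ∀ i < n, digit i x ∈ t (i + 1)} =
          ⋂ i, ⋂ (_ : i < n), digit i ⁻¹' (t (i + 1)) := by ext; simp
      rw [this]
      exact MeasurableSet.iInter fun i => MeasurableSet.iInter fun _ =>
        measurable_digit i (MeasurableSet.of_discrete)
    have key : {x : ℝ | ∀ i < n + 1, digit i x ∈ t i} ∩ Set.Ico 0 1 =
        ({x : ℝ | 0 ∈ t 0} ∩ (fun x : ℝ => 2 * x - 0) ⁻¹' B) ∪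
        ({x : ℝ | 1 ∈ t 0} ∩ (fun x : ℝ => 2 * x - 1) ⁻¹' B) := by
      ext x
      simp only [Set.mem_inter_iff, Set.mem_union, Set.mem_ofPred_eq, Set.mem_preimage, hB,
        Set.mem_Ico, sub_zero]
      constructor
      · rintro ⟨h, h0, h1⟩
        rcases lt_or_ge x (1 / 2) with hx | hx
        · left
          refine ⟨?_, ⟨fun i hi => ?_, by linarith, by linarith⟩⟩
          · have h2 := h 0 (by omega)
            rwa [digit_zero_left h0 hx] at h2
          · rw [← digit_succ_left]; exact h (i + 1) (by omega)
        · right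
          refine ⟨?_, ⟨fun i hi => ?_, by linarith, by linarith⟩⟩
          · have h2 := h 0 (by omega)
            rwa [digit_zero_right hx h1] at h2
          · rw [← digit_succ_right _ _ hx]; exact h (i + 1) (by omega)
      · rintro (⟨ha, hb, h0, h1⟩ | ⟨ha, hb, h0, h1⟩)
        · refine ⟨fun i hi => ?_, by linarith, by linarith⟩
          cases i with
          | zero => rw [digit_zero_left (by linarith) (by linarith)]; exact ha
          | succ i => rw [digit_succ_left]; exact hb i (by omega)
        · refine ⟨fun i hi => ?_, by linarith, by linarith⟩
          cases i with
          | zero => rw [digit_zero_right (by linarith) (by linarith)]; exact ha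
          | succ i => rw [digit_succ_right _ _ (by linarith)]; exact hb i (by omega)
    have hm2 : Measurable (fun x : ℝ => 2 * x - 1) := by fun_prop
    rw [key, measure_union]
    · rw [Finset.prod_range_succ', ← ih (fun i => t (i + 1)), ← hB]
      have e (P : Prop) (a : ℝ) : volume ({x : ℝ | P} ∩ (fun x : ℝ => 2 * x - a) ⁻¹' B) =
          (if P then 2⁻¹ else 0) * volume B := by
        by_cases hP : P
        · simp only [hP, Set.ofPred_true, Set.univ_inter, if_true]; exact volume_half a B
        · simp [hP]
      rw [e, e, ← add_mul, mul_comm (volume B)]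
      congr 1
      simp [coin, Set.indicator_apply]
    · rw [Set.disjoint_left]
      rintro x ⟨-, h1⟩ ⟨-, h2⟩
      have a := h1.2.2
      have b := h2.2.1
      simp at a b
      linarith
    · exact MeasurableSet.inter (MeasurableSet.const _) (hm2 hBm)

lemma map_digits : ((volume : Measure ℝ).restrict (Set.Ico 0 1)).map (fun x i => digit i x) =
    Measure.infinitePi (fun _ : ℕ => coin) := by
  have hD : Measurable (fun (x : ℝ) (i : ℕ) => digit i x) :=
    measurable_pi_iff.2 measurable_digit
  refine Measure.eq_infinitePi _ fun s t ht => ?_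
  have hms : MeasurableSet ((s : Set ℕ).pi t) := .pi s.countable_toSet fun _ _ => ht _
  rw [Measure.map_apply hD hms, Measure.restrict_apply (hD hms)]
  obtain ⟨n, hn⟩ := s.exists_nat_subset_range
  have := digits_cyl n (fun i => if i ∈ s then t i else Set.univ)
  have e1 : {x : ℝ | ∀ i < n, digit i x ∈ (if i ∈ s then t i else Set.univ)} =
      (fun (x : ℝ) (i : ℕ) => digit i x) ⁻¹' ((s : Set ℕ).pi t) := by
    ext x
    simp only [Set.mem_ofPred_eq, Set.mem_preimage, Set.mem_pi, Finset.mem_coe]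
    constructor
    · intro h i hi
      have := h i (by simpa using hn hi)
      simpa [hi] using this
    · intro h i _
      split_ifs with hi
      · exact h i hi
      · trivial
  rw [← e1, this, ← Finset.prod_subset hn]
  · exact Finset.prod_congr rfl fun i hi => by simp [hi]
  · intro i _ hi; simp [hi]

/-- The measure `P d p` is a product measure. -/
lemma P_eq_infinitePi (d : ℕ) (p : ℝ) : ∃ ν : Measure Bool, IsProbabilityMeasure ν ∧
    P d p = Measure.infinitePi (fun _ : Bond d => ν) := by
  let f : (ℕ → ℕ) → Bool :=
    fun a => if (∑' k : ℕ, (a k : ℝ) / 2 ^ (k + 1)) < p then true else false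
  have hf : Measurable f := by
    refine Measurable.ite (measurableSet_lt ?_ measurable_const) measurable_const measurable_const
    refine Measurable.tsum fun k => ?_
    have : Measurable (fun a : ℕ → ℕ => a k) := measurable_pi_apply k
    have h2 : Measurable (fun n : ℕ => (n : ℝ)) := measurable_from_top
    exact (h2.comp this).div_const _
  have henc : Function.Injective (enc d) := (exists_injective_nat (Bond d)).choose_spec
  let g : Bond d × ℕ → ℕ := fun q => Nat.pair (enc d q.1) q.2
  have hg : Function.Injective g := by
    rintro ⟨a, b⟩ ⟨a', b'⟩ h
    have := Nat.pair_eq_pair.1 h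
    exact Prod.ext (henc this.1) this.2
  have hD : Measurable (fun (x : ℝ) (i : ℕ) => digit i x) :=
    measurable_pi_iff.2 measurable_digit
  refine ⟨(Measure.infinitePi (fun _ : ℕ => coin)).map f,
    Measure.isProbabilityMeasure_map hf.aemeasurable, ?_⟩
  rw [← Measure.infinitePi_map_pi (μ := fun _ : Bond d => Measure.infinitePi (fun _ : ℕ => coin))
    (f := fun _ => f) (fun _ => hf),
    ← Measure.infinitePi_map_curry (fun (_ : Bond d) (_ : ℕ) => coin),
    ← Measure.map_infinitePi_infinitePi_of_inj (P := fun _ : ℕ => coin) hg, ← map_digits,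
    Measure.map_map, Measure.map_map, Measure.map_map]
  · rfl
  all_goals first | exact hD | fun_prop

end measure

section product

/-- The event `A` is determined by the bonds in `S`. -/
def Det (S : Finset (Bond 1)) (A : Set (Config 1)) : Prop :=
  ∀ ω ω' : Config 1, (∀ b ∈ S, ω b = ω' b) → ω ∈ A → ω' ∈ A

lemma Det.mono {S T : Finset (Bond 1)} {A : Set (Config 1)} (h : Det S A) (hST : S ⊆ T) :
    Det T A := fun ω ω' h1 h2 => h ω ω' (fun b hb => h1 b (hST hb)) h2

lemma Det.inter {S : Finset (Bond 1)} {A B : Set (Config 1)} (hA : Det S A) (hB : Det S B) :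
    Det S (A ∩ B) := fun ω ω' h h2 => ⟨hA ω ω' h h2.1, hB ω ω' h h2.2⟩

lemma Det.eq_preimage {S : Finset (Bond 1)} {A : Set (Config 1)} (h : Det S A) :
    A = S.restrict ⁻¹' ((S.restrict : Config 1 → _) '' A) := by
  refine Set.Subset.antisymm (Set.subset_preimage_image _ _) ?_
  rintro ω ⟨ω', h1, h2⟩
  exact h ω' ω (fun b hb => congrFun h2 ⟨b, hb⟩) h1

lemma Det.measurableSet {S : Finset (Bond 1)} {A : Set (Config 1)} (h : Det S A) :
    MeasurableSet A := by
  rw [h.eq_preimage]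
  exact (Finset.measurable_restrict S) (MeasurableSet.of_discrete)

/-- The probability of an event. -/
noncomputable def pr (p : ℝ) (A : Set (Config 1)) : ℝ := (P 1 p A).toReal

instance (d : ℕ) (p : ℝ) : IsProbabilityMeasure (P d p) := by
  obtain ⟨ν, hν, h⟩ := P_eq_infinitePi d p
  rw [h]; infer_instance

lemma pr_nonneg (p : ℝ) (A : Set (Config 1)) : 0 ≤ pr p A := ENNReal.toReal_nonneg

lemma pr_mono (p : ℝ) {A B : Set (Config 1)} (h : A ⊆ B) : pr p A ≤ pr p B :=
  measureReal_mono (μ := P 1 p) h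

lemma pr_union_le (p : ℝ) (A B : Set (Config 1)) : pr p (A ∪ B) ≤ pr p A + pr p B :=
  measureReal_union_le (μ := P 1 p) A B

lemma pr_indep (p : ℝ) {S T : Finset (Bond 1)} {A B : Set (Config 1)} (hST : Disjoint S T)
    (hA : Det S A) (hB : Det T B) : pr p (A ∩ B) = pr p A * pr p B := by
  obtain ⟨ν, hν, h⟩ := P_eq_infinitePi 1 p
  have h1 : ProbabilityTheory.iIndepFun (fun (b : Bond 1) (ω : Config 1) => ω b)
      (Measure.infinitePi (fun _ : Bond 1 => ν)) :=
    ProbabilityTheory.iIndepFun_infinitePi (X := fun _ x => x) (by fun_prop)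
  have h2 := h1.indepFun_finset S T hST (by fun_prop)
  have h3 := h2.measure_inter_preimage_eq_mul ((S.restrict : Config 1 → _) '' A)
    ((T.restrict : Config 1 → _) '' B) MeasurableSet.of_discrete MeasurableSet.of_discrete
  unfold pr
  rw [← ENNReal.toReal_mul, h]
  congr 1
  have eA : (fun (a : Config 1) (i : S) => a i) ⁻¹' ((S.restrict : Config 1 → _) '' A) = A :=
    hA.eq_preimage.symm
  have eB : (fun (a : Config 1) (i : T) => a i) ⁻¹' ((T.restrict : Config 1 → _) '' B) = B :=
    hB.eq_preimage.symm
  rw [eA, eB] at h3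
  exact h3

lemma pr_comp (p : ℝ) {σ : Bond 1 → Bond 1} (hσ : Function.Injective σ)
    {A : Set (Config 1)} (hA : MeasurableSet A) :
    pr p {ω | (fun b => ω (σ b)) ∈ A} = pr p A := by
  obtain ⟨ν, hν, h⟩ := P_eq_infinitePi 1 p
  unfold pr
  have := Measure.map_infinitePi_infinitePi_of_inj (P := fun _ : Bond 1 => ν) hσ
  rw [h]
  conv_rhs => rw [← this]
  rw [Measure.map_apply (by fun_prop) hA]
  rfl

lemma pr_fkg (p : ℝ) {S : Finset (Bond 1)} {A B : Set (Config 1)}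
    (hA : Det S A) (hB : Det S B) (uA : IsUpperSet A) (uB : IsUpperSet B) :
    pr p A * pr p B ≤ pr p (A ∩ B) := by
  obtain ⟨ν, hν, h⟩ := P_eq_infinitePi 1 p
  let m : (S → Bool) → ℝ := fun a => ∏ i, (ν {a i}).toReal
  have key : ∀ C : Set (Config 1), Det S C →
      pr p C = ∑ a, m a * (if a ∈ (S.restrict : Config 1 → _) '' C then 1 else 0) := by
    intro C hC
    unfold pr
    rw [h]
    conv_lhs => rw [hC.eq_preimage]
    rw [← Measure.map_apply (by fun_prop) MeasurableSet.of_discrete,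
      Measure.infinitePi_map_restrict]
    set D := (S.restrict : Config 1 → _) '' C
    have : D = ↑(Finset.univ.filter (fun a => a ∈ D)) := by ext; simp
    conv_lhs => rw [this, ← MeasureTheory.sum_measure_singleton]
    rw [ENNReal.toReal_sum (fun a _ => measure_ne_top _ _), Finset.sum_filter]
    refine Finset.sum_congr rfl fun a _ => ?_
    split_ifs
    · rw [Measure.pi_singleton, ENNReal.toReal_prod]; simp [m]
    · simp
  have mono : ∀ C : Set (Config 1), Det S C → IsUpperSet C → Monotone
      (fun a : S → Bool => if a ∈ (S.restrict : Config 1 → _) '' C then (1 : ℝ) else 0) := by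
    intro C hC uC a b hab
    dsimp only
    by_cases ha : a ∈ (S.restrict : Config 1 → _) '' C
    · have hb : b ∈ (S.restrict : Config 1 → _) '' C := by
        obtain ⟨ω, h1, h2⟩ := ha
        refine ⟨fun c => if hc : c ∈ S then b ⟨c, hc⟩ else ω c, uC (a := ω) ?_ h1, ?_⟩
        · intro c
          dsimp only
          split_ifs with hc
          · have := hab ⟨c, hc⟩
            rw [← h2] at this
            exact this
          · exact le_rfl
        · ext c
          simp
      simp only [ha, hb, if_true]; exact le_rfl
    · simp only [ha, if_false]; split_ifs <;> norm_num
  have hm : (0 : (S → Bool) → ℝ) ≤ m :=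
    fun a => Finset.prod_nonneg fun i _ => ENNReal.toReal_nonneg
  have tot : ∑ a, m a = 1 := by
    have := key Set.univ (fun _ _ _ _ => trivial)
    have e : pr p Set.univ = 1 := by simp [pr]
    rw [e] at this
    rw [this]
    refine Finset.sum_congr rfl fun a _ => ?_
    have : a ∈ (S.restrict : Config 1 → _) '' Set.univ :=
      ⟨fun c => if hc : c ∈ S then a ⟨c, hc⟩ else true, trivial, by ext c; simp⟩
    simp only [this, if_true, mul_one]
  have := fkg (μ := m) (f := fun a : S → Bool =>
      if a ∈ (S.restrict : Config 1 → _) '' A then (1 : ℝ) else 0)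
    (g := fun a : S → Bool => if a ∈ (S.restrict : Config 1 → _) '' B then (1 : ℝ) else 0)
    hm (fun a => by dsimp only; split_ifs <;> norm_num)
    (fun a => by dsimp only; split_ifs <;> norm_num) (mono A hA uA) (mono B hB uB)
    (fun a b => by
      simp only [m, ← Finset.prod_mul_distrib]
      refine le_of_eq (Finset.prod_congr rfl fun i _ => ?_)
      simp only [Pi.inf_apply, Pi.sup_apply]
      rcases a i with _ | _ <;> rcases b i with _ | _ <;> simp [mul_comm])
  rw [← key A hA, ← key B hB, tot, one_mul] at this
  refine this.trans (le_of_eq ?_)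
  rw [key _ (hA.inter hB)]
  refine Finset.sum_congr rfl fun a _ => ?_
  congr 1
  have : a ∈ (S.restrict : Config 1 → _) '' (A ∩ B) ↔
      a ∈ (S.restrict : Config 1 → _) '' A ∧ a ∈ (S.restrict : Config 1 → _) '' B := by
    constructor
    · rintro ⟨ω, h1, h2⟩; exact ⟨⟨ω, h1.1, h2⟩, ⟨ω, h1.2, h2⟩⟩
    · rintro ⟨⟨ω, h1, h2⟩, ⟨ω', h1', h2'⟩⟩
      refine ⟨ω, ⟨h1, hB ω' ω (fun b hb => ?_) h1'⟩, h2⟩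
      exact congrFun (h2'.trans h2.symm) ⟨b, hb⟩
  by_cases h1 : a ∈ (S.restrict : Config 1 → _) '' A <;>
  by_cases h2 : a ∈ (S.restrict : Config 1 → _) '' B <;>
  simp only [this, h1, h2, and_self, and_true, and_false, if_true, if_false, mul_one, mul_zero]

end product

section paths

/-- A single occupied step. -/
def Stp (ω : Config 1) (x : ℤ) (s : ℕ) (y : ℤ) : Prop :=
  |y - x| = 1 ∧ ω ((fun _ => x, s), fun _ => y) = true

/-- `v` restricted to `[s,t]` is an occupied path inside `[a,b]`. -/
def Path (ω : Config 1) (a b : ℤ) (v : ℕ → ℤ) (s t : ℕ) : Prop :=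
  (∀ j, s ≤ j → j ≤ t → a ≤ v j ∧ v j ≤ b) ∧ (∀ j, s ≤ j → j < t → Stp ω (v j) j (v (j + 1)))

/-- A general path event. -/
def Ev (a b : ℤ) (T : ℕ) (Q : ℕ → ℕ → (ℕ → ℤ) → Prop) : Set (Config 1) :=
  {ω | ∃ s u v, s ≤ u ∧ u ≤ T ∧ Q s u v ∧ Path ω a b v s u}

lemma const_eq (x : Fin 1 → ℤ) : (fun _ => x 0) = x := by
  ext i; rw [Subsingleton.elim i 0]

lemma norm1_eq (x y : Fin 1 → ℤ) : norm1 (x - y) = |x 0 - y 0| := by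
  simp [norm1]

lemma connIn_iff (ω : Config 1) (a b : ℤ) (T : ℕ) (x y : Fin 1 → ℤ) (s t : ℕ) :
    ConnectedIn ω (rect a b T) x s y t ↔
      s ≤ t ∧ t ≤ T ∧ ∃ v : ℕ → ℤ, v s = x 0 ∧ v t = y 0 ∧ Path ω a b v s t := by
  constructor
  · rintro (⟨rfl, rfl, h⟩ | ⟨h, v, rfl, rfl, h1, h2⟩)
    · refine ⟨le_rfl, h.2.2, fun _ => x 0, rfl, rfl, fun j _ _ => ⟨h.1, h.2.1⟩, fun j _ _ => ?_⟩
      omega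
    · refine ⟨h.le, (h1 t h.le le_rfl).2.2, fun j => v j 0, rfl, rfl, fun j hj hj' => ?_,
        fun j hj hj' => ?_⟩
      · exact ⟨(h1 j hj hj').1, (h1 j hj hj').2.1⟩
      · have := h2 j hj hj'
        rw [norm1_eq] at this
        exact ⟨this.1, by rw [const_eq, const_eq]; exact this.2⟩
  · rintro ⟨h, h', v, h1, h2, h3, h4⟩
    rcases h.eq_or_lt with rfl | h
    · left
      refine ⟨?_, rfl, ?_⟩
      · rw [← const_eq x, ← const_eq y, ← h1, ← h2]
      · have := h3 s le_rfl le_rfl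
        rw [h1] at this
        exact ⟨this.1, this.2, h'⟩
    · right
      refine ⟨h, fun j _ => v j, ?_, ?_, fun j hj hj' => ?_, fun j hj hj' => ?_⟩
      · rw [← const_eq x, ← h1]
      · rw [← const_eq y, ← h2]
      · exact ⟨(h3 j hj hj').1, (h3 j hj hj').2, hj'.trans h'⟩
      · rw [norm1_eq]; exact h4 j hj hj'

lemma conn_iff (ω : Config 1) (x : Fin 1 → ℤ) (t : ℕ) :
    Connected ω 0 0 x t ↔ ∃ v : ℕ → ℤ, v 0 = 0 ∧ v t = x 0 ∧ Path ω (-t) t v 0 t := by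
  constructor
  · rintro (⟨rfl, rfl, h⟩ | ⟨h, v, h0, rfl, h1, h2⟩)
    · refine ⟨fun _ => 0, rfl, rfl, fun j _ _ => by simp, fun j _ _ => by omega⟩
    · have hs : ∀ j, 0 ≤ j → j < t → Stp ω (v j 0) j (v (j + 1) 0) := by
        intro j hj hj'
        have := h2 j hj hj'
        rw [norm1_eq] at this
        exact ⟨this.1, by rw [const_eq, const_eq]; exact this.2⟩
      have hb : ∀ j : ℕ, j ≤ t → |v j 0| ≤ j := by
        intro j
        induction j with
        | zero => intro _; rw [h0]; simp
        | succ j ih =>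
          intro hj
          have h3 := (hs j (by omega) (by omega)).1
          have h4 := ih (by omega)
          push_cast
          rw [abs_le] at h4 ⊢
          have h5 := abs_le.1 h3.le
          constructor <;> linarith
      refine ⟨fun j => v j 0, by dsimp only; rw [h0]; rfl, rfl, fun j hj hj' => ?_, hs⟩
      have := abs_le.1 (hb j hj')
      have : (j : ℤ) ≤ t := by exact_mod_cast hj'
      constructor <;> linarith
  · rintro ⟨v, h1, h2, h3, h4⟩
    rcases Nat.eq_zero_or_pos t with rfl | h
    · left
      refine ⟨?_, rfl, trivial⟩
      rw [← const_eq x, ← h2, h1]; rfl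
    · right
      refine ⟨h, fun j _ => v j, ?_, ?_, fun j hj hj' => trivial, fun j hj hj' => ?_⟩
      · dsimp only; rw [h1]; rfl
      · rw [← const_eq x, ← h2]
      · rw [norm1_eq]; exact h4 j hj hj'

lemma Path.sub {ω : Config 1} {a b : ℤ} {v : ℕ → ℤ} {s t s' t' : ℕ} (h : Path ω a b v s t)
    (hs : s ≤ s') (ht : t' ≤ t) : Path ω a b v s' t' :=
  ⟨fun j h1 h2 => h.1 j (by omega) (by omega), fun j h1 h2 => h.2 j (by omega) (by omega)⟩

lemma Path.wid {ω : Config 1} {a b a' b' : ℤ} {v : ℕ → ℤ} {s t : ℕ} (h : Path ω a b v s t)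
    (ha : a' ≤ a) (hb : b ≤ b') : Path ω a' b' v s t :=
  ⟨fun j h1 h2 => ⟨ha.trans (h.1 j h1 h2).1, (h.1 j h1 h2).2.trans hb⟩, h.2⟩

lemma Path.parity {ω : Config 1} {a b : ℤ} {v : ℕ → ℤ} {s t : ℕ} (h : Path ω a b v s t) :
    ∀ k, s + k ≤ t → (Even (v (s + k) + ((s + k : ℕ) : ℤ)) ↔ Even (v s + s)) := by
  intro k
  induction k with
  | zero => intro _; simp
  | succ k ih =>
    intro hk
    rw [← ih (by omega)]
    have h1 := (h.2 (s + k) (by omega) (by omega)).1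
    have e : s + (k + 1) = s + k + 1 := by ring
    rw [e]
    rcases (abs_eq (by norm_num : (0 : ℤ) ≤ 1)).1 h1 with h2 | h2
    · have : v (s + k + 1) + ((s + k + 1 : ℕ) : ℤ) = (v (s + k) + ((s + k : ℕ) : ℤ)) + 2 := by
        push_cast; linarith
      rw [this, Int.even_add]; simp
    · have : v (s + k + 1) + ((s + k + 1 : ℕ) : ℤ) = (v (s + k) + ((s + k : ℕ) : ℤ)) := by
        push_cast; linarith
      rw [this]

lemma Path.parity' {ω : Config 1} {a b : ℤ} {v : ℕ → ℤ} {s t : ℕ} (h : Path ω a b v s t)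
    {i j : ℕ} (hi : s ≤ i) (hi' : i ≤ t) (hj : s ≤ j) (hj' : j ≤ t)
    (he : Even (v i + i)) : Even (v j + j) := by
  obtain ⟨k, rfl⟩ := Nat.exists_eq_add_of_le hi
  obtain ⟨l, rfl⟩ := Nat.exists_eq_add_of_le hj
  rw [h.parity l hj', ← h.parity k hi']
  exact he

/-- Concatenation of paths. -/
lemma Path.cat {ω : Config 1} {a b : ℤ} {u v : ℕ → ℤ} {s j t : ℕ} (hu : Path ω a b u s j)
    (hv : Path ω a b v j t) (huv : u j = v j) :
    Path ω a b (fun i => if i ≤ j then u i else v i) s t := by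
  constructor
  · intro i h1 h2
    dsimp only
    split_ifs with h
    · exact hu.1 i h1 h
    · exact hv.1 i (by omega) h2
  · intro i h1 h2
    dsimp only
    rcases lt_trichotomy i j with h | h | h
    · rw [if_pos (by omega), if_pos (by omega)]; exact hu.2 i h1 h
    · subst h
      rw [if_pos le_rfl, if_neg (by omega), huv]; exact hv.2 i le_rfl h2
    · rw [if_neg (by omega), if_neg (by omega)]; exact hv.2 i h.le h2

/-- Two paths on the even sublattice which change their order must meet. -/
lemma meet {ω : Config 1} {a b a' b' : ℤ} {u v : ℕ → ℤ} {s t : ℕ} (hst : s ≤ t)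
    (hu : Path ω a b u s t) (hv : Path ω a' b' v s t)
    (eu : Even (u s + s)) (ev : Even (v s + s)) (h0 : u s ≤ v s) (h1 : v t ≤ u t) :
    ∃ j, s ≤ j ∧ j ≤ t ∧ u j = v j := by
  by_contra hcon
  push Not at hcon
  have : ∀ k, s + k ≤ t → u (s + k) < v (s + k) := by
    intro k
    induction k with
    | zero => intro _; exact lt_of_le_of_ne h0 (hcon s le_rfl hst)
    | succ k ih =>
      intro hk
      have h2 := ih (by omega)
      have h3 := hcon (s + (k + 1)) (by omega) hk
      have h4 := abs_le.1 (hu.2 (s + k) (by omega) (by omega)).1.le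
      have h5 := abs_le.1 (hv.2 (s + k) (by omega) (by omega)).1.le
      have e1 := hu.parity' le_rfl hst (j := s + (k + 1)) (by omega) hk eu
      have e2 := hv.parity' le_rfl hst (j := s + (k + 1)) (by omega) hk ev
      have e3 := hu.parity' le_rfl hst (j := s + k) (by omega) (by omega) eu
      have e4 := hv.parity' le_rfl hst (j := s + k) (by omega) (by omega) ev
      have e : s + (k + 1) = s + k + 1 := by ring
      rw [e] at h3 e1 e2 ⊢
      rw [Int.even_iff] at e1 e2 e3 e4
      omega
  have h2 := this (t - s) (by omega)
  rw [Nat.add_sub_cancel' hst] at h2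
  omega

/-- The bonds inside the column `[a,b] × [0,T]`. -/
noncomputable def col (a b : ℤ) (T : ℕ) : Finset (Bond 1) :=
  ((((Finset.Icc a b) ×ˢ (Finset.range T)) ×ˢ (Finset.Icc a b)).filter
    (fun q => |q.2 - q.1.1| = 1)).image (fun q => ((fun _ => q.1.1, q.1.2), fun _ => q.2))

lemma mem_col {a b : ℤ} {T : ℕ} {c : Bond 1} : c ∈ col a b T ↔
    (a ≤ c.1.1 0 ∧ c.1.1 0 ≤ b) ∧ c.1.2 < T ∧ (a ≤ c.2 0 ∧ c.2 0 ≤ b) ∧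
      |c.2 0 - c.1.1 0| = 1 := by
  simp only [col, Finset.mem_image, Finset.mem_filter, Finset.mem_product, Finset.mem_Icc,
    Finset.mem_range]
  constructor
  · rintro ⟨q, ⟨⟨⟨h1, h2⟩, h3⟩, h4⟩, rfl⟩
    exact ⟨h1, h2, h3, h4⟩
  · rintro ⟨h1, h2, h3, h4⟩
    refine ⟨((c.1.1 0, c.1.2), c.2 0), ⟨⟨⟨h1, h2⟩, h3⟩, h4⟩, ?_⟩
    simp only [const_eq]

lemma col_disjoint {a b b' c : ℤ} {T : ℕ} (h : b ≤ b') :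
    Disjoint (col a b T) (col b' c T) := by
  rw [Finset.disjoint_left]
  intro e h1 h2
  rw [mem_col] at h1 h2
  have h3 : e.2 0 - e.1.1 0 = 0 := by omega
  have := h1.2.2.2
  rw [h3] at this
  simp at this

lemma col_mono {a b a' b' : ℤ} {T : ℕ} (ha : a' ≤ a) (hb : b ≤ b') :
    col a b T ⊆ col a' b' T := by
  intro e h1
  rw [mem_col] at h1 ⊢
  exact ⟨⟨ha.trans h1.1.1, h1.1.2.trans hb⟩, h1.2.1, ⟨ha.trans h1.2.2.1.1,
    h1.2.2.1.2.trans hb⟩, h1.2.2.2⟩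

lemma Ev_det (a b : ℤ) (T : ℕ) (Q : ℕ → ℕ → (ℕ → ℤ) → Prop) : Det (col a b T) (Ev a b T Q) := by
  rintro ω ω' h ⟨s, u, v, h1, h2, h3, h4, h5⟩
  refine ⟨s, u, v, h1, h2, h3, h4, fun j hj hj' => ⟨(h5 j hj hj').1, ?_⟩⟩
  rw [← h]
  · exact (h5 j hj hj').2
  · rw [mem_col]
    exact ⟨h4 j hj hj'.le, by simp; omega, h4 (j + 1) (by omega) hj', (h5 j hj hj').1⟩

lemma Ev_upper (a b : ℤ) (T : ℕ) (Q : ℕ → ℕ → (ℕ → ℤ) → Prop) : IsUpperSet (Ev a b T Q) := by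
  rintro ω ω' h ⟨s, u, v, h1, h2, h3, h4, h5⟩
  refine ⟨s, u, v, h1, h2, h3, h4, fun j hj hj' => ⟨(h5 j hj hj').1, ?_⟩⟩
  have := h ((fun _ => v j, j), fun _ => v (j + 1))
  rw [(h5 j hj hj').2] at this
  exact le_antisymm (Bool.le_true _) this

lemma pr_trans (p : ℝ) (k a b a' b' : ℤ) (T : ℕ) (Q Q' : ℕ → ℕ → (ℕ → ℤ) → Prop)
    (ha : a' = a + k) (hb : b' = b + k)
    (h : ∀ s u v, s ≤ u → u ≤ T → Q s u v → Q' s u (fun j => v j + k)) :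
    pr p (Ev a b T Q) ≤ pr p (Ev a' b' T Q') := by
  subst ha hb
  let σ : Bond 1 → Bond 1 := fun c => ((fun i => c.1.1 i + k, c.1.2), fun i => c.2 i + k)
  have hσ : Function.Injective σ := by
    rintro ⟨⟨x, s⟩, y⟩ ⟨⟨x', s'⟩, y'⟩ h
    simp only [σ, Prod.mk.injEq] at h
    obtain ⟨⟨h1, h2⟩, h3⟩ := h
    have h1' : x = x' := by ext i; have := congrFun h1 i; simpa using this
    have h3' : y = y' := by ext i; have := congrFun h3 i; simpa using this
    rw [h1', h2, h3']
  rw [← pr_comp p hσ (Ev_det a b T Q).measurableSet]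
  apply pr_mono
  rintro ω ⟨s, u, v, h1, h2, h3, h4, h5⟩
  refine ⟨s, u, fun j => v j + k, h1, h2, h s u v h1 h2 h3, fun j hj hj' => ?_,
    fun j hj hj' => ⟨?_, ?_⟩⟩
  · have := h4 j hj hj'
    constructor <;> dsimp only <;> linarith
  · have := (h5 j hj hj').1
    rwa [add_sub_add_right_eq_sub]
  · exact (h5 j hj hj').2

lemma pr_refl (p : ℝ) (a b a' b' : ℤ) (T : ℕ) (Q Q' : ℕ → ℕ → (ℕ → ℤ) → Prop)
    (ha : a' = -b) (hb : b' = -a)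
    (h : ∀ s u v, s ≤ u → u ≤ T → Q s u v → Q' s u (fun j => -v j)) :
    pr p (Ev a b T Q) ≤ pr p (Ev a' b' T Q') := by
  subst ha hb
  let σ : Bond 1 → Bond 1 := fun c => ((fun i => -c.1.1 i, c.1.2), fun i => -c.2 i)
  have hσ : Function.Injective σ := by
    rintro ⟨⟨x, s⟩, y⟩ ⟨⟨x', s'⟩, y'⟩ h
    simp only [σ, Prod.mk.injEq] at h
    obtain ⟨⟨h1, h2⟩, h3⟩ := h
    have h1' : x = x' := by ext i; have := congrFun h1 i; simpa using this
    have h3' : y = y' := by ext i; have := congrFun h3 i; simpa using this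
    rw [h1', h2, h3']
  rw [← pr_comp p hσ (Ev_det a b T Q).measurableSet]
  apply pr_mono
  rintro ω ⟨s, u, v, h1, h2, h3, h4, h5⟩
  refine ⟨s, u, fun j => -v j, h1, h2, h s u v h1 h2 h3, fun j hj hj' => ?_,
    fun j hj hj' => ⟨?_, ?_⟩⟩
  · have := h4 j hj hj'
    constructor <;> dsimp only <;> linarith
  · have := (h5 j hj hj').1
    rw [← abs_neg]; rw [← this]; congr 1; ring
  · exact (h5 j hj hj').2

lemma pr_rev (p : ℝ) (k a b a' b' : ℤ) (T : ℕ) (Q Q' : ℕ → ℕ → (ℕ → ℤ) → Prop)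
    (ha : a' = a + k) (hb : b' = b + k)
    (h : ∀ s u v, s ≤ u → u ≤ T → Q s u v → Q' (T - u) (T - s) (fun j => v (T - j) + k)) :
    pr p (Ev a b T Q) ≤ pr p (Ev a' b' T Q') := by
  subst ha hb
  let σ : Bond 1 → Bond 1 := fun c => if c.1.2 < T then
    ((fun i => c.2 i + k, T - 1 - c.1.2), fun i => c.1.1 i + k) else c
  have hσ : Function.Injective σ := by
    rintro ⟨⟨x, s⟩, y⟩ ⟨⟨x', s'⟩, y'⟩ h
    by_cases hs : s < T <;> by_cases hs' : s' < T <;>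
      simp only [σ, hs, hs', if_true, if_false, Prod.mk.injEq] at h
    · obtain ⟨⟨h1, h2⟩, h3⟩ := h
      have h1' : y = y' := by ext i; have := congrFun h1 i; simpa using this
      have h3' : x = x' := by ext i; have := congrFun h3 i; simpa using this
      have : s = s' := by omega
      rw [h1', this, h3']
    · omega
    · omega
    · simp [h]
  rw [← pr_comp p hσ (Ev_det a b T Q).measurableSet]
  apply pr_mono
  rintro ω ⟨s, u, v, h1, h2, h3, h4, h5⟩
  refine ⟨T - u, T - s, fun j => v (T - j) + k, by omega, by omega, h s u v h1 h2 h3,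
    fun j hj hj' => ?_, fun j hj hj' => ?_⟩
  · have := h4 (T - j) (by omega) (by omega)
    constructor <;> dsimp only <;> linarith
  · have h6 := h5 (T - (j + 1)) (by omega) (by omega)
    have e : T - (j + 1) + 1 = T - j := by omega
    rw [e] at h6
    refine ⟨?_, ?_⟩
    · have := h6.1
      rw [abs_sub_comm, add_sub_add_right_eq_sub]; exact this
    · have := h6.2
      simp only [σ] at this
      rw [if_pos (by omega)] at this
      have e2 : T - 1 - (T - (j + 1)) = j := by omega
      rw [e2] at this
      exact this

end paths

section upper

/-- Connection of the origin to the boundary of the box. -/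
def QA (w T : ℕ) : ℕ → ℕ → (ℕ → ℤ) → Prop :=
  fun s u v => s = 0 ∧ v 0 = 0 ∧ (u = T ∨ |v u| = w)

/-- Connection of `(x,T)` to the boundary of its box, backward in time. -/
def QB (w T : ℕ) (x : ℤ) : ℕ → ℕ → (ℕ → ℤ) → Prop :=
  fun s u v => u = T ∧ v T = x ∧ (s = 0 ∨ |v s - x| = w)

/-- Horizontal crossing. -/
def QH (a b : ℤ) : ℕ → ℕ → (ℕ → ℤ) → Prop :=
  fun s u v => (v s = a ∧ v u = b) ∨ (v s = b ∧ v u = a)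

/-- Point to point connection. -/
def QT (T : ℕ) (x : ℤ) : ℕ → ℕ → (ℕ → ℤ) → Prop :=
  fun s u v => s = 0 ∧ u = T ∧ v 0 = 0 ∧ v T = x

lemma tau_eq (p : ℝ) (x : Fin 1 → ℤ) (T : ℕ) :
    tau 1 p x T = pr p (Ev (-T) T T (QT T (x 0))) := by
  unfold tau pr
  congr 2
  ext ω
  rw [Set.mem_ofPred_eq, conn_iff]
  constructor
  · rintro ⟨v, h1, h2, h3⟩
    exact ⟨0, T, v, by omega, le_rfl, ⟨rfl, rfl, h1, h2⟩, h3⟩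
  · rintro ⟨s, u, v, h1, h2, ⟨rfl, rfl, h3, h4⟩, h5⟩
    exact ⟨v, h3, h4, h5⟩

lemma firstHit (g : ℕ → ℤ) (T : ℕ) (d : ℤ) (hg : ∀ j < T, |g (j + 1) - g j| ≤ 1)
    (h0 : g 0 < d) (h1 : d ≤ g T) : ∃ u ≤ T, g u = d ∧ ∀ j ≤ u, g j ≤ d := by
  have hex : ∃ u, d ≤ g u := ⟨T, h1⟩
  set u := Nat.find hex with hu
  have hle : u ≤ T := Nat.find_min' hex h1
  have hspec : d ≤ g u := Nat.find_spec hex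
  have hlt : ∀ j < u, g j < d := fun j hj => not_le.1 (Nat.find_min hex hj)
  have hu0 : u ≠ 0 := by
    intro h; rw [h] at hspec; omega
  have h3 := hlt (u - 1) (by omega)
  have h4 := abs_le.1 (hg (u - 1) (by omega))
  rw [Nat.sub_add_cancel (by omega)] at h4
  have h5 : g u = d := by omega
  refine ⟨u, hle, h5, fun j hj => ?_⟩
  rcases hj.eq_or_lt with h | h
  · rw [h, h5]
  · exact (hlt j h).le

lemma lastHit (g : ℕ → ℤ) (T : ℕ) (c : ℤ) (hg : ∀ j < T, |g (j + 1) - g j| ≤ 1)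
    (h0 : g 0 ≤ c) (h1 : c < g T) : ∃ s ≤ T, g s = c ∧ ∀ j, s ≤ j → j ≤ T → c ≤ g j := by
  obtain ⟨u, h2, h3, h4⟩ := firstHit (fun j => -g (T - j)) T (-c) (by
    intro j hj
    have := hg (T - (j + 1)) (by omega)
    have e : T - (j + 1) + 1 = T - j := by omega
    rw [e] at this
    have e2 : -g (T - (j + 1)) - -g (T - j) = g (T - j) - g (T - (j + 1)) := by ring
    rw [e2]; exact this) (by simpa using h1) (by simpa using h0)
  refine ⟨T - u, by omega, by omega, fun j hj hj' => ?_⟩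
  have := h4 (T - j) (by omega)
  rw [Nat.sub_sub_self hj'] at this
  omega

lemma Path.lip {ω : Config 1} {a b : ℤ} {v : ℕ → ℤ} {T : ℕ} (h : Path ω a b v 0 T) :
    ∀ j < T, |v (j + 1) - v j| ≤ 1 := fun j hj => (h.2 j (by omega) hj).1.le

lemma exists_cross {ω : Config 1} {a b : ℤ} {v : ℕ → ℤ} {T : ℕ} (h : Path ω a b v 0 T)
    {c d : ℤ} (hcd : c < d) (h0 : v 0 ≤ c) (h1 : d ≤ v T) : ω ∈ Ev c d T (QH c d) := by
  obtain ⟨u, hu, h2, h3⟩ := firstHit v T d h.lip (by omega) h1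
  obtain ⟨s, hs, h4, h5⟩ := lastHit v u c (fun j hj => h.lip j (by omega)) h0 (by omega)
  exact ⟨s, u, v, hs, hu, Or.inl ⟨h4, h2⟩, fun j hj hj' => ⟨h5 j hj hj', h3 j hj'⟩,
    fun j hj hj' => h.2 j (by omega) (by omega)⟩

lemma exists_start {ω : Config 1} {a b : ℤ} {v : ℕ → ℤ} {T : ℕ} (h : Path ω a b v 0 T)
    {w : ℕ} (hw : 1 ≤ w) (h0 : v 0 = 0) (h1 : (w : ℤ) ≤ v T) :
    ω ∈ Ev (-w) w T (QA w T) := by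
  obtain ⟨u, hu, h2, h3⟩ := firstHit (fun j => |v j|) T w
    (fun j hj => (abs_abs_sub_abs_le_abs_sub _ _).trans (h.lip j hj))
    (by simp only [h0, abs_zero]; omega) (h1.trans (le_abs_self _))
  exact ⟨0, u, v, by omega, hu, ⟨rfl, h0, Or.inr h2⟩, fun j hj hj' => abs_le.1 (h3 j hj'),
    fun j hj hj' => h.2 j (by omega) (by omega)⟩

lemma exists_end {ω : Config 1} {a b : ℤ} {v : ℕ → ℤ} {T : ℕ} (h : Path ω a b v 0 T)
    {w : ℕ} (hw : 1 ≤ w) {x : ℤ} (h0 : v 0 ≤ x - w) (h1 : v T = x) :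
    ω ∈ Ev (x - w) (x + w) T (QB w T x) := by
  obtain ⟨s, hs, h2, h3⟩ := lastHit (fun j => -|v j - x|) T (-w)
    (fun j hj => by
      have e : -|v (j + 1) - x| - -|v j - x| = |v j - x| - |v (j + 1) - x| := by ring
      rw [e]
      refine (abs_abs_sub_abs_le_abs_sub _ _).trans ?_
      rw [sub_sub_sub_cancel_right, abs_sub_comm]; exact h.lip j hj)
    (by
      have := neg_abs_le (v 0 - x)
      have := neg_le_abs (v 0 - x)
      omega) (by simp [h1]; omega)
  refine ⟨s, T, v, hs, le_rfl, ⟨rfl, h1, Or.inr (by omega)⟩,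
    fun j hj hj' => ?_, fun j hj hj' => h.2 j (by omega) (by omega)⟩
  have h4 := h3 j hj hj'
  have := abs_le.1 (show |v j - x| ≤ w by omega)
  constructor <;> omega

/-- The chain of crossings event. -/
def chain (w T : ℕ) : ℕ → Set (Config 1)
  | 0 => Ev (-w) w T (QA w T)
  | k + 1 => chain w T k ∩ Ev (w + k * w) (w + k * w + w) T (QH (w + k * w) (w + k * w + w))

lemma chain_det (w T k : ℕ) : Det (col (-w) (w + k * w) T) (chain w T k) := by
  induction k with
  | zero => simpa [chain] using Ev_det (-w) w T (QA w T)
  | succ k ih =>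
    refine Det.inter (ih.mono (col_mono le_rfl ?_)) ((Ev_det _ _ _ _).mono (col_mono ?_ ?_))
    · push_cast; nlinarith
    · have : (0 : ℤ) ≤ k * w := by positivity
      linarith
    · push_cast; nlinarith

lemma chain_le (p q : ℝ) (w T k : ℕ) (hq : pr p (Ev 0 w T (QH 0 w)) ≤ q) :
    pr p (chain w T k) ≤ pr p (Ev (-w) w T (QA w T)) * q ^ k := by
  induction k with
  | zero => simp [chain]
  | succ k ih =>
    rw [chain, pr_indep p (col_disjoint le_rfl) (chain_det w T k) (Ev_det _ _ _ _), pow_succ,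
      ← mul_assoc]
    refine mul_le_mul ih (le_trans ?_ hq) (pr_nonneg _ _) ?_
    · refine pr_trans p (-(w + k * w)) _ _ _ _ T _ _ (by ring) (by ring) ?_
      rintro s u v - - (⟨h1, h2⟩ | ⟨h1, h2⟩)
      · left; dsimp only; constructor <;> omega
      · right; dsimp only; constructor <;> omega
    · exact (pr_nonneg _ _).trans ih

lemma pr_QB (p : ℝ) (w T : ℕ) (x : ℤ) :
    pr p (Ev (x - w) (x + w) T (QB w T x)) ≤ pr p (Ev (-w) w T (QA w T)) := by
  refine pr_rev p (-x) _ _ _ _ T _ _ (by ring) (by ring) ?_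
  rintro s u v h h' ⟨rfl, h1, h2⟩
  refine ⟨by omega, by simp [h1], ?_⟩
  rcases h2 with rfl | h2
  · left; omega
  · right
    dsimp only
    rw [Nat.sub_sub_self (by omega)]
    rw [← sub_eq_add_neg]; exact h2

lemma tau_upper_pos (p q : ℝ) (w T k : ℕ) (hw : 1 ≤ w)
    (hq : pr p (Ev 0 w T (QH 0 w)) ≤ q) (x : ℤ)
    (hx : ((k : ℤ) + 2) * w ≤ x) :
    pr p (Ev (-T) T T (QT T x)) ≤ pr p (Ev (-w) w T (QA w T)) ^ 2 * q ^ k := by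
  have h1 : Ev (-T) T T (QT T x) ⊆ chain w T k ∩ Ev (x - w) (x + w) T (QB w T x) := by
    rintro ω ⟨s, u, v, -, -, ⟨rfl, rfl, h0, h1⟩, h⟩
    have hkw : (0 : ℤ) ≤ k * w := by positivity
    refine ⟨?_, exists_end h hw (by rw [h0]; nlinarith) h1⟩
    have : ∀ l ≤ k, ω ∈ chain w u l := by
      intro l
      induction l with
      | zero => intro _; exact exists_start h hw h0 (by rw [h1]; nlinarith)
      | succ l ih =>
        intro hl
        refine ⟨ih (by omega), exists_cross h (by omega) ?_ ?_⟩
        · rw [h0]; positivity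
        · rw [h1]
          have : (l : ℤ) + 1 ≤ k := by exact_mod_cast hl
          nlinarith
    exact this k le_rfl
  refine (pr_mono p h1).trans ?_
  rw [pr_indep p (col_disjoint (by linarith)) (chain_det w T k) (Ev_det _ _ _ _), sq,
    mul_right_comm]
  have := chain_le p q w T k hq
  exact mul_le_mul this (pr_QB p w T x) (pr_nonneg _ _) ((pr_nonneg _ _).trans this)

lemma tau_upper (p q : ℝ) (w T k : ℕ) (hw : 1 ≤ w)
    (hq : pr p (Ev 0 w T (QH 0 w)) ≤ q) (x : ℤ)
    (hx : ((k : ℤ) + 2) * w ≤ |x|) :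
    pr p (Ev (-T) T T (QT T x)) ≤ pr p (Ev (-w) w T (QA w T)) ^ 2 * q ^ k := by
  refine le_trans ?_ (tau_upper_pos p q w T k hw hq |x| hx)
  rcases abs_choice x with h | h
  · rw [h]
  · rw [h]
    refine pr_refl p _ _ _ _ T _ _ rfl (by ring) ?_
    rintro s u v - - ⟨h1, h2, h3, h4⟩
    exact ⟨h1, h2, by simp [h3], by simp [h4]⟩

end upper

section lower

/-- Vertical crossing on the even sublattice. -/
def QV (T : ℕ) : ℕ → ℕ → (ℕ → ℤ) → Prop :=
  fun s u v => s = 0 ∧ u = T ∧ Even (v 0)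

/-- Vertical crossing on the odd sublattice. -/
def QVo (T : ℕ) : ℕ → ℕ → (ℕ → ℤ) → Prop :=
  fun s u v => s = 0 ∧ u = T ∧ ¬ Even (v 0)

/-- Left to right crossing on the even sublattice. -/
def QL (a b : ℤ) : ℕ → ℕ → (ℕ → ℤ) → Prop :=
  fun s u v => v s = a ∧ v u = b ∧ Even (v s + s)

/-- Left to right crossing on the odd sublattice. -/
def QLo (a b : ℤ) : ℕ → ℕ → (ℕ → ℤ) → Prop :=
  fun s u v => v s = a ∧ v u = b ∧ ¬ Even (v s + s)

/-- Right to left crossing on the even sublattice. -/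
def QR (a b : ℤ) : ℕ → ℕ → (ℕ → ℤ) → Prop := QL b a

/-- Right to left crossing on the odd sublattice. -/
def QRo (a b : ℤ) : ℕ → ℕ → (ℕ → ℤ) → Prop := QLo b a

/-- Survival from the origin up to time `T`. -/
def QG (T : ℕ) : ℕ → ℕ → (ℕ → ℤ) → Prop :=
  fun s u v => s = 0 ∧ u = T ∧ v 0 = 0

/-- Backward survival from `(x,T)`. -/
def QG' (T : ℕ) (x : ℤ) : ℕ → ℕ → (ℕ → ℤ) → Prop :=
  fun s u v => s = 0 ∧ u = T ∧ v T = x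

lemma H_ge (p : ℝ) (w t : ℕ) : pr p (Ev 0 w t (QH 0 w)) ≤ H p w (3 * t) := by
  refine pr_mono p ?_
  rintro ω ⟨s, u, v, h1, h2, (⟨h3, h4⟩ | ⟨h3, h4⟩), h5⟩
  · exact ⟨fun _ => 0, fun _ => w, s, u, rfl, rfl, Or.inl ((connIn_iff _ _ _ _ _ _ _ _).2
      ⟨h1, by omega, v, h3, h4, h5⟩)⟩
  · exact ⟨fun _ => 0, fun _ => w, u, s, rfl, rfl, Or.inr ((connIn_iff _ _ _ _ _ _ _ _).2
      ⟨h1, by omega, v, h3, h4, h5⟩)⟩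

lemma exists_vert (p ε : ℝ) (w t : ℕ) (h : ε ≤ V p w (3 * t)) :
    ∃ c : ℤ, (c = -1 ∨ c = 0) ∧ ε / 2 ≤ pr p (Ev c (c + w) t (QV t)) ∧
      ε / 2 ≤ pr p (Ev (-c - w) (-c) t (QV t)) := by
  have h1 : V p w (3 * t) ≤ pr p (Ev 0 w t (QV t) ∪ Ev 0 w t (QVo t)) := by
    refine pr_mono p ?_
    rintro ω ⟨x, y, h⟩
    rw [connIn_iff] at h
    obtain ⟨-, -, v, h1, h2, h3⟩ := h
    by_cases he : Even (v 0)
    · exact Or.inl ⟨0, t, v, by omega, le_rfl, ⟨rfl, rfl, he⟩, h3.sub le_rfl (by omega)⟩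
    · exact Or.inr ⟨0, t, v, by omega, le_rfl, ⟨rfl, rfl, he⟩, h3.sub le_rfl (by omega)⟩
  have h2 := pr_union_le p (Ev 0 w t (QV t)) (Ev 0 w t (QVo t))
  have h3 : ∃ c : ℤ, (c = -1 ∨ c = 0) ∧ ε / 2 ≤ pr p (Ev c (c + w) t (QV t)) := by
    by_cases h4 : ε / 2 ≤ pr p (Ev 0 w t (QV t))
    · exact ⟨0, Or.inr rfl, by simpa using h4⟩
    · refine ⟨-1, Or.inl rfl, le_trans (b := pr p (Ev 0 w t (QVo t))) (by linarith) ?_⟩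
      refine pr_trans p (-1) _ _ _ _ t _ _ (by ring) (by ring) ?_
      rintro s u v - - ⟨h5, h6, h7⟩
      refine ⟨h5, h6, ?_⟩
      rw [Int.even_iff] at h7 ⊢
      dsimp only
      omega
  obtain ⟨c, hc, h4⟩ := h3
  refine ⟨c, hc, h4, h4.trans ?_⟩
  refine pr_refl p _ _ _ _ t _ _ (by ring) (by ring) ?_
  rintro s u v - - ⟨h5, h6, h7⟩
  exact ⟨h5, h6, by simpa using h7⟩

lemma exists_horiz (p ε : ℝ) (W t : ℕ) (h : ε ≤ H p W t) :
    ∃ c : ℤ, (∀ a : ℤ, Even (a - c) → ε / 4 ≤ pr p (Ev a (a + W) t (QL a (a + W)))) ∧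
      (∀ a : ℤ, Even (a - c) → ε / 4 ≤ pr p (Ev (-a - W) (-a) t (QR (-a - W) (-a)))) := by
  have h1 : H p W t ≤ pr p ((Ev 0 W t (QL 0 W) ∪ Ev 0 W t (QLo 0 W)) ∪
      (Ev 0 W t (QR 0 W) ∪ Ev 0 W t (QRo 0 W))) := by
    refine pr_mono p ?_
    rintro ω ⟨x, y, s, u, hx, hy, (h | h)⟩
    · rw [connIn_iff] at h
      obtain ⟨h0, h0', v, h1, h2, h3⟩ := h
      left
      by_cases he : Even (v s + s)
      · exact Or.inl ⟨s, u, v, h0, h0', ⟨h1.trans hx, h2.trans hy, he⟩, h3⟩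
      · exact Or.inr ⟨s, u, v, h0, h0', ⟨h1.trans hx, h2.trans hy, he⟩, h3⟩
    · rw [connIn_iff] at h
      obtain ⟨h0, h0', v, h1, h2, h3⟩ := h
      right
      by_cases he : Even (v u + u)
      · exact Or.inl ⟨u, s, v, h0, h0', ⟨h1.trans hy, h2.trans hx, he⟩, h3⟩
      · exact Or.inr ⟨u, s, v, h0, h0', ⟨h1.trans hy, h2.trans hx, he⟩, h3⟩
  have h2 := pr_union_le p (Ev 0 W t (QL 0 W) ∪ Ev 0 W t (QLo 0 W))
      (Ev 0 W t (QR 0 W) ∪ Ev 0 W t (QRo 0 W))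
  have h3 := pr_union_le p (Ev 0 W t (QL 0 W)) (Ev 0 W t (QLo 0 W))
  have h4 := pr_union_le p (Ev 0 W t (QR 0 W)) (Ev 0 W t (QRo 0 W))
  have odd : ∀ z : ℤ, ¬ Even z → Even (z - 1) := by
    intro z hz; rw [Int.even_iff] at *; omega
  have h5 : ∃ c : ℤ, ε / 4 ≤ pr p (Ev c (c + W) t (QL c (c + W))) := by
    by_cases h6 : ε / 4 ≤ pr p (Ev 0 W t (QL 0 W))
    · exact ⟨0, by simpa using h6⟩
    by_cases h7 : ε / 4 ≤ pr p (Ev 0 W t (QLo 0 W))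
    · refine ⟨-1, h7.trans ?_⟩
      refine pr_trans p (-1) _ _ _ _ t _ _ (by ring) (by ring) ?_
      rintro s u v - - ⟨h5, h6, h7⟩
      refine ⟨by simp [h5], by simp [h6]; ring, ?_⟩
      rw [Int.even_iff] at h7 ⊢
      dsimp only
      omega
    by_cases h8 : ε / 4 ≤ pr p (Ev 0 W t (QR 0 W))
    · refine ⟨-W, h8.trans ?_⟩
      refine pr_refl p _ _ _ _ t _ _ (by ring) (by ring) ?_
      rintro s u v - - ⟨h5, h6, h7⟩
      refine ⟨by simp [h5], by simp [h6], ?_⟩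
      rw [Int.even_iff] at h7 ⊢
      dsimp only
      omega
    have h9 : ε / 4 ≤ pr p (Ev 0 W t (QRo 0 W)) := by linarith
    have h10 : pr p (Ev 0 W t (QRo 0 W)) ≤ pr p (Ev (-1) (-1 + W) t (QR (-1) (-1 + W))) := by
      refine pr_trans p (-1) _ _ _ _ t _ _ (by ring) (by ring) ?_
      rintro s u v - - ⟨h5, h6, h7⟩
      refine ⟨by simp [h5]; ring, by simp [h6], ?_⟩
      rw [Int.even_iff] at h7 ⊢
      dsimp only
      omega
    refine ⟨1 - W, (h9.trans h10).trans ?_⟩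
    refine pr_refl p _ _ _ _ t _ _ (by ring) (by ring) ?_
    rintro s u v - - ⟨h5, h6, h7⟩
    refine ⟨by simp [h5]; ring, by simp [h6], ?_⟩
    rw [Int.even_iff] at h7 ⊢
    dsimp only
    omega
  obtain ⟨c, hc⟩ := h5
  have hL : ∀ a : ℤ, Even (a - c) → ε / 4 ≤ pr p (Ev a (a + W) t (QL a (a + W))) := by
    intro a ha
    refine hc.trans ?_
    refine pr_trans p (a - c) _ _ _ _ t _ _ (by ring) (by ring) ?_
    rintro s u v - - ⟨h5, h6, h7⟩
    refine ⟨by simp [h5], by simp [h6]; ring, ?_⟩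
    rw [Int.even_iff] at h7 ha ⊢
    dsimp only
    omega
  refine ⟨c, hL, fun a ha => (hL a ha).trans ?_⟩
  refine pr_refl p _ _ _ _ t _ _ (by ring) (by ring) ?_
  rintro s u v - - ⟨h5, h6, h7⟩
  refine ⟨by simp [h5], by simp [h6]; ring, ?_⟩
  rw [Int.even_iff] at h7 ⊢
  dsimp only
  omega

/-- Gluing the origin's connection with vertical crossings. -/
lemma glue_vert {w t : ℕ} (hw : 1 ≤ w) {c : ℤ} (hc : c = -1 ∨ c = 0) :
    Ev (-w) w t (QA w t) ∩ (Ev c (c + w) t (QV t) ∩ Ev (-c - w) (-c) t (QV t)) ⊆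
      Ev (-w) w t (QG t) := by
  rintro ω ⟨⟨s, u, v, -, hu, ⟨rfl, h1, h2⟩, hv⟩, ⟨s1, u1, r, -, -, ⟨rfl, rfl, h3⟩, hr⟩,
    ⟨s2, u2, l, -, -, ⟨rfl, rfl, h4⟩, hl⟩⟩
  rcases h2 with rfl | h2
  · exact ⟨0, u, v, by omega, le_rfl, ⟨rfl, rfl, h1⟩, hv⟩
  have hu0 : Even (v 0 + (0 : ℕ)) := by simp [h1]
  have hr0 : Even (r 0 + (0 : ℕ)) := by simpa using h3
  have hl0 : Even (l 0 + (0 : ℕ)) := by simpa using h4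
  have fin : ∀ r : ℕ → ℤ, Path ω (-w) w r 0 u2 → (∃ j, 0 ≤ j ∧ j ≤ u ∧ v j = r j) →
      ω ∈ Ev (-w) w u2 (QG u2) := by
    rintro r hr ⟨j, -, hj, hj'⟩
    refine ⟨0, u2, _, by omega, le_rfl, ⟨rfl, rfl, ?_⟩,
      (hv.sub le_rfl hj).cat (hr.sub (Nat.zero_le j) le_rfl) hj'⟩
    simp [h1]
  rcases (abs_eq (by positivity : (0 : ℤ) ≤ w)).1 h2 with h5 | h5
  · refine fin r (hr.wid (by omega) (by omega)) ?_
    refine meet (Nat.zero_le u) hv (hr.sub le_rfl hu) hu0 hr0 ?_ ?_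
    · have := (hr.1 0 le_rfl (by omega)).1
      rw [Int.even_iff] at h3
      omega
    · have := (hr.1 u (by omega) hu).2
      omega
  · refine fin l (hl.wid (by omega) (by omega)) ?_
    obtain ⟨j, h6, h7, h8⟩ := meet (Nat.zero_le u) (hl.sub le_rfl hu) hv hl0 hu0 (by
      have := (hl.1 0 le_rfl (by omega)).2
      rw [Int.even_iff] at h4
      omega) (by
      have := (hl.1 u (by omega) hu).1
      omega)
    exact ⟨j, h6, h7, h8.symm⟩

/-- Gluing everything. -/
lemma glue_all {w t : ℕ} {x a a' : ℤ} (hx : Even (x + t))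
    (h1 : a ≤ -w) (h2 : a ≤ x - w) (h3 : (w : ℤ) ≤ a + (3 * w : ℕ))
    (h4 : x + w ≤ a + (3 * w : ℕ))
    (h1' : a' ≤ -w) (h2' : a' ≤ x - w) (h3' : (w : ℤ) ≤ a' + (3 * w : ℕ))
    (h4' : x + w ≤ a' + (3 * w : ℕ)) :
    (Ev (-w) w t (QG t) ∩ Ev (x - w) (x + w) t (QG' t x)) ∩
      (Ev a (a + (3 * w : ℕ)) t (QL a (a + (3 * w : ℕ))) ∩
        Ev a' (a' + (3 * w : ℕ)) t (QR a' (a' + (3 * w : ℕ)))) ⊆ Ev (-t) t t (QT t x) := by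
  rintro ω ⟨⟨⟨s1, u1, γ, -, -, ⟨rfl, rfl, g1⟩, hγ⟩, ⟨s2, u2, β, -, -, ⟨rfl, rfl, b1⟩, hβ⟩⟩,
    ⟨s3, u3, ρ, r0, r0', ⟨r1, r2, r3⟩, hρ⟩, ⟨s4, u4, η, n0, n0', ⟨n1, n2, n3⟩, hη⟩⟩
  -- it suffices to find a path in a wider column
  have fin : ∀ m : ℤ, ∀ v : ℕ → ℤ, v 0 = 0 → v u2 = x → Path ω (-m) m v 0 u2 →
      ω ∈ Ev (-u2) u2 u2 (QT u2 x) := by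
    intro m v h1 h2 h3
    have hb : ∀ j : ℕ, j ≤ u2 → |v j| ≤ j := by
      intro j
      induction j with
      | zero => intro _; rw [h1]; simp
      | succ j ih =>
        intro hj
        have h4 := abs_le.1 (ih (by omega))
        have h5 := abs_le.1 (h3.lip j (by omega))
        push_cast
        rw [abs_le]
        constructor <;> linarith
    refine ⟨0, u2, v, by omega, le_rfl, ⟨rfl, rfl, h1, h2⟩, fun j _ hj => ?_, h3.2⟩
    have := abs_le.1 (hb j hj)
    constructor <;> omega
  obtain ⟨m, hm⟩ : ∃ m : ℤ, m = 3 * w + |a| + |a'| + |x| := ⟨_, rfl⟩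
  have := le_abs_self a
  have := neg_abs_le a
  have := le_abs_self a'
  have := neg_abs_le a'
  have := le_abs_self x
  have := neg_abs_le x
  have Pγ : Path ω (-m) m γ 0 u2 := hγ.wid (by omega) (by omega)
  have Pβ : Path ω (-m) m β 0 u2 := hβ.wid (by omega) (by omega)
  have Pρ : Path ω (-m) m ρ s3 u3 := hρ.wid (by omega) (by push_cast; omega)
  have Pη : Path ω (-m) m η s4 u4 := hη.wid (by omega) (by push_cast; omega)
  have eγ : Even (γ 0 + (0 : ℕ)) := by simp [g1]
  have eβ : Even (β u2 + u2) := by rw [b1]; exact hx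
  -- direct meeting
  have direct : (∃ j, j ≤ u2 ∧ γ j = β j) → ω ∈ Ev (-u2) u2 u2 (QT u2 x) := by
    rintro ⟨j, hj, hj'⟩
    refine fin m _ ?_ ?_ ((Pγ.sub le_rfl hj).cat (Pβ.sub (Nat.zero_le j) le_rfl) hj')
    · simp [g1]
    · try dsimp only
      split_ifs with h
      · have : j = u2 := by omega
        subst this; rw [hj', b1]
      · exact b1
  -- meeting through a crossing
  have via : ∀ ρ : ℕ → ℤ, ∀ s u j k : ℕ, Path ω (-m) m ρ s u → s ≤ j → j ≤ k → k ≤ u → u ≤ u2 →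
      γ j = ρ j → ρ k = β k → ω ∈ Ev (-u2) u2 u2 (QT u2 x) := by
    intro ρ s u j k hρ h1 h2 h3 h4 h5 h6
    have c1 := (Pγ.sub le_rfl (show j ≤ u2 by omega)).cat (hρ.sub h1 h3) h5
    have c2 := c1.cat (Pβ.sub (Nat.zero_le k) le_rfl) (by
      try dsimp only
      split_ifs with h
      · have : j = k := by omega
        subst this; rw [h5, h6]
      · exact h6)
    refine fin m _ ?_ ?_ c2
    · simp [g1]
    · try dsimp only
      split_ifs with h h'
      · have e1 : k = u2 := by omega
        have e2 : j = u2 := by omega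
        rw [← e2, h5, e2, ← e1, h6, e1, b1]
      · have e1 : k = u2 := by omega
        rw [← e1, h6, e1, b1]
      · exact b1
  have evγ : ∀ j, j ≤ u2 → Even (γ j + j) := fun j hj =>
    Pγ.parity' le_rfl (Nat.zero_le _) (Nat.zero_le _) hj eγ
  have evβ : ∀ j, j ≤ u2 → Even (β j + j) := fun j hj =>
    Pβ.parity' (Nat.zero_le _) le_rfl (Nat.zero_le _) hj eβ
  have evρ : ∀ j, s3 ≤ j → j ≤ u3 → Even (ρ j + j) := fun j hj hj' =>
    Pρ.parity' le_rfl r0 hj hj' r3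
  have evη : ∀ j, s4 ≤ j → j ≤ u4 → Even (η j + j) := fun j hj hj' =>
    Pη.parity' le_rfl n0 hj hj' n3
  rcases le_total (γ 0) (β 0) with h0 | h0
  · obtain ⟨j, j1, j2, j3⟩ := meet r0 Pρ (Pγ.sub (Nat.zero_le _) r0') r3 (evγ _ (by omega))
      (by have := (hγ.1 s3 (by omega) (by omega)).1; omega)
      (by have := (hγ.1 u3 (by omega) (by omega)).2; omega)
    rcases le_total (γ j) (β j) with h5 | h5
    · obtain ⟨k, k1, k2, k3⟩ := meet j2 (Pρ.sub j1 le_rfl) (Pβ.sub (Nat.zero_le _) r0')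
        (evρ j j1 j2) (evβ j (by omega)) (by omega)
        (by have := (hβ.1 u3 (by omega) (by omega)).2; omega)
      exact via ρ s3 u3 j k Pρ j1 k1 k2 r0' j3.symm k3
    · obtain ⟨k, -, k2, k3⟩ := meet (Nat.zero_le j) (Pγ.sub le_rfl (by omega))
        (Pβ.sub le_rfl (by omega)) eγ (evβ 0 (by omega)) h0 h5
      exact direct ⟨k, by omega, k3⟩
  · obtain ⟨j, j1, j2, j3⟩ := meet n0 (Pγ.sub (Nat.zero_le _) n0') Pη (evγ _ (by omega)) n3
      (by have := (hγ.1 s4 (by omega) (by omega)).2; omega)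
      (by have := (hγ.1 u4 (by omega) (by omega)).1; omega)
    rcases le_total (β j) (γ j) with h5 | h5
    · obtain ⟨k, k1, k2, k3⟩ := meet j2 (Pβ.sub (Nat.zero_le _) n0') (Pη.sub j1 le_rfl)
        (evβ j (by omega)) (evη j j1 j2) (by omega)
        (by have := (hβ.1 u4 (by omega) (by omega)).1; omega)
      exact via η s4 u4 j k Pη j1 k1 k2 n0' j3 k3.symm
    · obtain ⟨k, -, k2, k3⟩ := meet (Nat.zero_le j) (Pβ.sub le_rfl (by omega))
        (Pγ.sub le_rfl (by omega)) (evβ 0 (by omega)) eγ h0 h5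
      exact direct ⟨k, by omega, k3.symm⟩

lemma fkg_Ev (p : ℝ) {S : Finset (Bond 1)} {A B : Set (Config 1)} {a b : ℝ}
    (hA : Det S A) (hB : Det S B) (uA : IsUpperSet A) (uB : IsUpperSet B) (ha : 0 ≤ a)
    (hb : 0 ≤ b) (h1 : a ≤ pr p A) (h2 : b ≤ pr p B) : a * b ≤ pr p (A ∩ B) :=
  (mul_le_mul h1 h2 hb (ha.trans h1)).trans (pr_fkg p hA hB uA uB)

lemma tau_lower (p ε : ℝ) (hε : 0 < ε) (w t : ℕ) (hw : 2 ≤ w)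
    (hV : ε ≤ V p w (3 * t)) (hH : ε ≤ H p (3 * w) t) (x : ℤ) (hx : Even (x + t))
    (hx' : |x| ≤ w - 1) :
    pr p (Ev (-w) w t (QA w t)) ^ 2 * ((ε / 2) ^ 4 * (ε / 4) ^ 2) ≤
      pr p (Ev (-t) t t (QT t x)) := by
  obtain ⟨c, hc, v1, v2⟩ := exists_vert p ε w t hV
  obtain ⟨c', l1, l2⟩ := exists_horiz p ε (3 * w) t hH
  set A := pr p (Ev (-w) w t (QA w t)) with hA
  have hA0 : 0 ≤ A := pr_nonneg _ _
  have hx1 := abs_le.1 hx'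
  obtain ⟨N, hN⟩ : ∃ N : ℤ, N = 10 * w := ⟨_, rfl⟩
  have D : ∀ a b Q, -N ≤ a → b ≤ N → Det (col (-N) N t) (Ev a b t Q) := fun a b Q h1 h2 =>
    (Ev_det a b t Q).mono (col_mono h1 h2)
  have G1 : A * ((ε / 2) * (ε / 2)) ≤ pr p (Ev (-w) w t (QG t)) := by
    refine le_trans ?_ (pr_mono p (glue_vert (by omega) hc))
    refine fkg_Ev p (S := col (-N) N t) (D _ _ _ ?_ ?_) (Det.inter (D _ _ _ ?_ ?_) (D _ _ _ ?_ ?_))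
      (Ev_upper _ _ _ _) ((Ev_upper _ _ _ _).inter (Ev_upper _ _ _ _)) hA0 (by positivity) le_rfl
      (fkg_Ev p (S := col (-N) N t) (D _ _ _ ?_ ?_) (D _ _ _ ?_ ?_) (Ev_upper _ _ _ _)
        (Ev_upper _ _ _ _) (by positivity) (by positivity) v1 v2) <;> omega
  have G2 : A * ((ε / 2) * (ε / 2)) ≤ pr p (Ev (x - w) (x + w) t (QG' t x)) := by
    refine G1.trans ?_
    refine pr_rev p x _ _ _ _ t _ _ (by ring) (by ring) ?_
    rintro s u v - - ⟨rfl, rfl, h⟩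
    exact ⟨by omega, by omega, by simp [h]⟩
  -- choose the left endpoints
  have ex : ∃ a : ℤ, Even (a - c') ∧ a ≤ -w ∧ a ≤ x - w ∧ (w : ℤ) ≤ a + (3 * w : ℕ) ∧
      x + w ≤ a + (3 * w : ℕ) := by
    by_cases he : Even (-w + min x 0 - c')
    · exact ⟨-w + min x 0, he, by omega, by omega, by push_cast; omega, by push_cast; omega⟩
    · refine ⟨-w + min x 0 - 1, ?_, by omega, by omega, by push_cast; omega, by push_cast; omega⟩
      rw [Int.even_iff] at he ⊢
      omega
  have ex' : ∃ a : ℤ, Even (a - c') ∧ -a - (3 * w : ℕ) ≤ -w ∧ -a - (3 * w : ℕ) ≤ x - w ∧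
      (w : ℤ) ≤ -a ∧ x + w ≤ -a := by
    by_cases he : Even (-w - max x 0 - c')
    · exact ⟨-w - max x 0, he, by push_cast; omega, by push_cast; omega, by omega, by omega⟩
    · refine ⟨-w - max x 0 - 1, ?_, by push_cast; omega, by push_cast; omega, by omega, by omega⟩
      rw [Int.even_iff] at he ⊢
      omega
  obtain ⟨a, a0, a1, a2, a3, a4⟩ := ex
  obtain ⟨d, d0, d1, d2, d3, d4⟩ := ex'
  have L := l1 a a0
  have R := l2 d d0
  obtain ⟨a', ha'⟩ : ∃ a' : ℤ, a' = -d - (3 * w : ℕ) := ⟨_, rfl⟩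
  have hd : -d = a' + (3 * w : ℕ) := by rw [ha']; ring
  rw [← ha', hd] at R
  rw [← ha'] at d1 d2
  rw [hd] at d3 d4
  have hNa : -N ≤ a := by push_cast at *; omega
  have hNa2 : a + (3 * w : ℕ) ≤ N := by push_cast at *; omega
  have hNa' : -N ≤ a' := by push_cast at *; omega
  have hNa2' : a' + (3 * w : ℕ) ≤ N := by push_cast at *; omega
  refine le_trans ?_ (pr_mono p (glue_all hx a1 a2 a3 a4 d1 d2 d3 d4))
  have := fkg_Ev p (S := col (-N) N t)
    (Det.inter (D (-w) w (QG t) (by omega) (by omega))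
      (D (x - w) (x + w) (QG' t x) (by omega) (by omega)))
    (Det.inter (D a _ (QL a (a + (3 * w : ℕ))) hNa hNa2)
      (D a' _ (QR a' (a' + (3 * w : ℕ))) hNa' hNa2'))
    ((Ev_upper _ _ _ _).inter (Ev_upper _ _ _ _)) ((Ev_upper _ _ _ _).inter (Ev_upper _ _ _ _))
    (by positivity) (by positivity)
    (fkg_Ev p (S := col (-N) N t) (D (-w) w (QG t) (by omega) (by omega))
      (D (x - w) (x + w) (QG' t x) (by omega) (by omega))
      (Ev_upper _ _ _ _) (Ev_upper _ _ _ _) (by positivity) (by positivity) G1 G2)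
    (fkg_Ev p (S := col (-N) N t) (D a _ (QL a (a + (3 * w : ℕ))) hNa hNa2)
      (D a' _ (QR a' (a' + (3 * w : ℕ))) hNa' hNa2')
      (Ev_upper _ _ _ _) (Ev_upper _ _ _ _) (by positivity) (by positivity) L R)
  refine le_trans (le_of_eq ?_) this
  ring

end lower

/-! ### Final assembly -/

/-- The weights occurring in the tail sum. -/
noncomputable def gw (q : ℝ) (j : ℕ) : ℝ := ((j : ℝ) + 1) ^ 2 * q ^ (j - 2)

lemma gw_nonneg {q : ℝ} (hq : 0 ≤ q) (j : ℕ) : 0 ≤ gw q j := by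
  unfold gw; positivity

lemma gw_summable {q : ℝ} (h0 : 0 < q) (h1 : q < 1) : Summable (gw q) := by
  rw [← summable_nat_add_iff 2]
  have hq : ‖q‖ < 1 := by rw [Real.norm_of_nonneg h0.le]; exact h1
  have a2 := summable_pow_mul_geometric_of_norm_lt_one 2 hq
  have a1 := summable_pow_mul_geometric_of_norm_lt_one 1 hq
  have a0 := summable_pow_mul_geometric_of_norm_lt_one 0 hq
  have := (a2.add (a1.mul_left 6)).add (a0.mul_left 9)
  refine this.congr fun n => ?_
  unfold gw
  simp only [Nat.add_sub_cancel]
  push_cast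
  ring

lemma gw_sum {q : ℝ} (h0 : 0 < q) (h1 : q < 1) (t w : ℕ) (hw : 1 ≤ w) :
    ∑ z ∈ Finset.Icc (-(t : ℤ)) t, gw q (z.natAbs / w) ≤ 2 * w * ∑' j, gw q j := by
  have hm : ∀ z ∈ Finset.Icc (-(t : ℤ)) t, z.natAbs / w ∈ Finset.range (t + 1) := by
    intro z hz
    rw [Finset.mem_Icc] at hz
    rw [Finset.mem_range]
    have := Nat.div_le_self z.natAbs w
    omega
  rw [← Finset.sum_fiberwise_of_maps_to hm]
  have hcard : ∀ j, ((Finset.Icc (-(t : ℤ)) t).filter fun z => z.natAbs / w = j).card ≤ 2 * w := by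
    intro j
    have hs : ((Finset.Icc (-(t : ℤ)) t).filter fun z => z.natAbs / w = j) ⊆
        Finset.Ico ((j * w : ℕ) : ℤ) ((j * w + w : ℕ) : ℤ) ∪
          Finset.Ioc (-((j * w + w : ℕ) : ℤ)) (-((j * w : ℕ) : ℤ)) := by
      intro z hz
      rw [Finset.mem_filter] at hz
      obtain ⟨-, hz⟩ := hz
      rw [Nat.div_eq_iff (by omega)] at hz
      rw [Finset.mem_union, Finset.mem_Ico, Finset.mem_Ioc]
      generalize j * w = m at *
      omega
    refine (Finset.card_le_card hs).trans ((Finset.card_union_le _ _).trans ?_)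
    rw [Int.card_Ico, Int.card_Ioc]
    generalize j * w = m
    omega
  calc _ ≤ ∑ j ∈ Finset.range (t + 1), 2 * w * gw q j := by
        refine Finset.sum_le_sum fun j _ => ?_
        rw [Finset.sum_congr rfl (g := fun _ => gw q j) (by
          intro z hz; rw [(Finset.mem_filter.1 hz).2])]
        rw [Finset.sum_const, nsmul_eq_mul]
        refine mul_le_mul_of_nonneg_right ?_ (gw_nonneg h0.le j)
        exact_mod_cast hcard j
    _ = 2 * w * ∑ j ∈ Finset.range (t + 1), gw q j := by rw [Finset.mul_sum]
    _ ≤ _ := by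
        refine mul_le_mul_of_nonneg_left ?_ (by positivity)
        exact (gw_summable h0 h1).sum_le_tsum _ fun j _ => gw_nonneg h0.le j

/-- Purely analytic form of the final estimate. -/
lemma final_bound {q c A : ℝ} (h0 : 0 < q) (h1 : q < 1) (hc : 0 < c) (t w : ℕ) (hw : 2 ≤ w)
    (f : ℤ → ℝ) (hf : ∀ z, 0 ≤ f z) (hz : ∀ z : ℤ, (t : ℤ) < |z| → f z = 0)
    (hup : ∀ (k : ℕ) (z : ℤ), ((k : ℤ) + 2) * w ≤ |z| → f z ≤ A ^ 2 * q ^ k)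
    (hlo : ∀ z : ℤ, Even (z + t) → |z| ≤ (w : ℤ) - 1 → A ^ 2 * c ≤ f z) :
    ∑ z ∈ Finset.Icc (-(t : ℤ)) t, (z : ℝ) ^ 2 * f z ≤
      (4 + 4 * (∑' j, gw q j) / c) * w ^ 2 * ∑ z ∈ Finset.Icc (-(t : ℤ)) t, f z := by
  set K := ∑' j, gw q j with hK
  have hK0 : 0 ≤ K := tsum_nonneg fun j => gw_nonneg h0.le j
  set S := ∑ z ∈ Finset.Icc (-(t : ℤ)) t, f z with hS
  have hA : 0 ≤ A ^ 2 := sq_nonneg A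
  have hpt : ∀ z : ℤ, (z : ℝ) ^ 2 * f z ≤
      4 * w ^ 2 * f z + A ^ 2 * w ^ 2 * gw q (z.natAbs / w) := by
    intro z
    have hg := gw_nonneg h0.le (z.natAbs / w)
    by_cases h : |z| < 2 * w
    · have : (z : ℝ) ^ 2 ≤ 4 * w ^ 2 := by
        have h2 : |(z : ℝ)| < 2 * w := by exact_mod_cast h
        have h3 := abs_nonneg (z : ℝ)
        rw [← sq_abs]
        nlinarith
      have := mul_le_mul_of_nonneg_right this (hf z)
      have : 0 ≤ A ^ 2 * w ^ 2 * gw q (z.natAbs / w) := by positivity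
      linarith
    · push Not at h
      have hj : 2 ≤ z.natAbs / w := by
        rw [Nat.le_div_iff_mul_le (by omega)]
        rw [Int.abs_eq_natAbs] at h
        omega
      have e1 := Nat.div_mul_le_self z.natAbs w
      have e2 := Nat.lt_div_mul_add (a := z.natAbs) (b := w) (by omega)
      unfold gw at hg ⊢
      generalize z.natAbs / w = j at *
      obtain ⟨k, rfl⟩ := Nat.exists_eq_add_of_le' hj
      have hb := hup k z (by
        rw [Int.abs_eq_natAbs]
        exact_mod_cast e1)
      have hz2 : (z : ℝ) ^ 2 ≤ (((k + 2 : ℕ) : ℝ) + 1) ^ 2 * w ^ 2 := by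
        have h2 : |(z : ℝ)| ≤ (((k + 2 : ℕ) : ℝ) + 1) * w := by
          have : (z.natAbs : ℝ) ≤ ((k + 2 : ℕ) : ℝ) * w + w := by exact_mod_cast e2.le
          rw [Nat.cast_natAbs, Int.cast_abs] at this
          linarith
        rw [← sq_abs, ← mul_pow]
        exact pow_le_pow_left₀ (abs_nonneg _) h2 2
      have h5 := mul_le_mul hz2 hb (hf z) (by positivity)
      have h6 : 0 ≤ 4 * (w : ℝ) ^ 2 * f z := by have := hf z; positivity
      rw [Nat.add_sub_cancel]
      nlinarith
  have hup' : ∑ z ∈ Finset.Icc (-(t : ℤ)) t, (z : ℝ) ^ 2 * f z ≤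
      4 * w ^ 2 * S + A ^ 2 * w ^ 2 * (2 * w * K) := by
    refine (Finset.sum_le_sum fun z _ => hpt z).trans ?_
    rw [Finset.sum_add_distrib, ← Finset.mul_sum, ← Finset.mul_sum]
    have := mul_le_mul_of_nonneg_left (gw_sum h0 h1 t w (by omega))
      (show 0 ≤ A ^ 2 * (w : ℝ) ^ 2 by positivity)
    linarith
  have hlow : (w : ℝ) / 2 * (A ^ 2 * c) ≤ S := by
    obtain ⟨δ, hδ, hpar⟩ : ∃ δ : ℤ, (δ = 0 ∨ δ = 1) ∧ Even (-((w : ℤ) - 1) + δ + t) := by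
      rcases Int.even_or_odd (-((w : ℤ) - 1) + t) with h | h
      · exact ⟨0, Or.inl rfl, by simpa using h⟩
      · refine ⟨1, Or.inr rfl, ?_⟩
        rw [Int.odd_iff] at h
        rw [Int.even_iff]
        omega
    let φ : ℕ → ℤ := fun i => -((w : ℤ) - 1) + δ + 2 * i
    have hφ : Function.Injective φ := by
      intro i j h
      simp only [φ] at h
      omega
    have hB : ((Finset.range (w - 1)).image φ).card = w - 1 := by
      rw [Finset.card_image_of_injective _ hφ, Finset.card_range]
    set B := (Finset.range (w - 1)).image φ with hBdef
    have hBf : ∀ z ∈ B, A ^ 2 * c ≤ f z := by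
      intro z hzB
      rw [hBdef, Finset.mem_image] at hzB
      obtain ⟨i, hi, rfl⟩ := hzB
      rw [Finset.mem_range] at hi
      apply hlo
      · rw [Int.even_iff] at hpar ⊢
        simp only [φ]
        omega
      · simp only [φ]
        rw [abs_le]
        omega
    have h3 : ∑ z ∈ B, f z ≤ S := by
      have : ∑ z ∈ B, f z = ∑ z ∈ B ∩ Finset.Icc (-(t : ℤ)) t, f z := by
        symm
        apply Finset.sum_subset Finset.inter_subset_left
        intro z hzB hzn
        apply hz
        by_contra hcon
        push Not at hcon
        rw [abs_le] at hcon
        exact hzn (Finset.mem_inter.2 ⟨hzB, Finset.mem_Icc.2 hcon⟩)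
      rw [this]
      exact Finset.sum_le_sum_of_subset_of_nonneg Finset.inter_subset_right fun z _ _ => hf z
    have h4 := Finset.card_nsmul_le_sum B f _ hBf
    rw [hB, nsmul_eq_mul] at h4
    have h5 : (w : ℝ) / 2 ≤ ((w - 1 : ℕ) : ℝ) := by
      rw [Nat.cast_sub (by omega)]
      have : (2 : ℝ) ≤ w := by exact_mod_cast hw
      push_cast
      linarith
    have := mul_le_mul_of_nonneg_right h5 (show 0 ≤ A ^ 2 * c by positivity)
    linarith
  have h7 : A ^ 2 * w ^ 2 * (2 * w * K) = (4 * K / c * w ^ 2) * ((w : ℝ) / 2 * (A ^ 2 * c)) := by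
    field_simp
    ring
  have h8 := mul_le_mul_of_nonneg_left hlow (show 0 ≤ 4 * K / c * (w : ℝ) ^ 2 by positivity)
  calc _ ≤ _ := hup'
    _ ≤ 4 * w ^ 2 * S + (4 * K / c * w ^ 2) * S := by rw [h7]; linarith
    _ = _ := by ring

lemma tau_zero (p : ℝ) (t : ℕ) (z : ℤ) (hz : (t : ℤ) < |z|) :
    pr p (Ev (-t) t t (QT t z)) = 0 := by
  have : Ev (-t) t t (QT t z) = ∅ := by
    rw [Set.eq_empty_iff_forall_notMem]
    rintro ω ⟨s, u, v, -, -, ⟨rfl, rfl, -, h⟩, hp, -⟩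
    have := hp u (Nat.zero_le _) le_rfl
    rw [h] at this
    have := abs_le.2 this
    omega
  rw [this]
  simp [pr]

lemma sum_conv (p : ℝ) (t : ℕ) (h : ℤ → ℝ) :
    ∑' x : Fin 1 → ℤ, h (x 0) * tau 1 p x t =
      ∑ z ∈ Finset.Icc (-(t : ℤ)) t, h z * pr p (Ev (-t) t t (QT t z)) := by
  simp only [tau_eq]
  rw [← tsum_eq_sum (L := SummationFilter.unconditional ℤ) (f := fun z : ℤ => h z * pr p (Ev (-t) t t (QT t z))) (by
    intro z hz
    rw [tau_zero, mul_zero]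
    by_contra hcon
    push Not at hcon
    exact hz (Finset.mem_Icc.2 (abs_le.1 hcon)))]
  exact (Equiv.funUnique (Fin 1) ℤ).tsum_eq
    (fun z : ℤ => h z * pr p (Ev (-t) t t (QT t z)))

/-- for every `ε ∈ (0,1)` there is a constant `C = C(ε) > 0` such
that, for `d = 1`, `p = p_c`, `t ≥ 1` and any integer `w ≥ 2` with
`V_{p_c}(w, 3t) ≥ ε`, `H_{p_c}(3w, t) ≥ ε` and `H_{p_c}(w, 3t) ≤ 1 - ε`, the gyration
radius satisfies `ξ_t ≤ C w`. -/
theorem xi_upper_bound_from_crossings (ε : ℝ) (hε : ε ∈ Set.Ioo (0 : ℝ) 1) :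
    ∃ C : ℝ, 0 < C ∧ ∀ t w : ℕ, 1 ≤ t → 2 ≤ w →
      ε ≤ V (pc 1) w (3 * t) → ε ≤ H (pc 1) (3 * w) t → H (pc 1) w (3 * t) ≤ 1 - ε →
      xi 1 (pc 1) t ≤ C * w := by
  obtain ⟨h0, h1⟩ := hε
  set c : ℝ := (ε / 2) ^ 4 * (ε / 4) ^ 2 with hc
  have hc0 : 0 < c := by positivity
  set K := ∑' j, gw (1 - ε) j with hK
  have hK0 : 0 ≤ K := tsum_nonneg fun j => gw_nonneg (by linarith) j
  set M : ℝ := 4 + 4 * K / c with hM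
  have hM0 : 0 < M := by positivity
  refine ⟨Real.sqrt M, Real.sqrt_pos.2 hM0, ?_⟩
  intro t w _ hw hV hH hH'
  have key := final_bound (q := 1 - ε) (c := c)
    (A := pr (pc 1) (Ev (-w) w t (QA w t))) (by linarith) (by linarith) hc0 t w hw
    (fun z => pr (pc 1) (Ev (-t) t t (QT t z))) (fun z => pr_nonneg _ _)
    (fun z hz => tau_zero _ t z hz)
    (fun k z hz => tau_upper (pc 1) (1 - ε) w t k (by omega) ((H_ge _ _ _).trans hH') z hz)
    (fun z hz hz' => tau_lower (pc 1) ε h0 w t hw hV hH z hz hz')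
  have e1 : ∑' x : Fin 1 → ℤ, (normSq x : ℝ) * tau 1 (pc 1) x t =
      ∑ z ∈ Finset.Icc (-(t : ℤ)) t, (z : ℝ) ^ 2 * pr (pc 1) (Ev (-t) t t (QT t z)) := by
    rw [← sum_conv (pc 1) t fun z => (z : ℝ) ^ 2]
    simp [normSq]
  have e2 : chi 1 (pc 1) t =
      ∑ z ∈ Finset.Icc (-(t : ℤ)) t, pr (pc 1) (Ev (-t) t t (QT t z)) := by
    have := sum_conv (pc 1) t fun _ => (1 : ℝ)
    simpa [chi] using this
  unfold xi
  rw [e1]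
  rw [← e2] at key
  have hchi : 0 ≤ chi 1 (pc 1) t := by
    rw [e2]
    exact Finset.sum_nonneg fun z _ => pr_nonneg _ _
  have hsq : Real.sqrt M * (w : ℝ) = Real.sqrt (M * w ^ 2) := by
    rw [Real.sqrt_mul hM0.le, Real.sqrt_sq (by positivity)]
  rw [hsq]
  exact Real.sqrt_le_sqrt (div_le_of_le_mul₀ hchi (by positivity) key)

end OrientedPercolation
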